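/- There exist an uncountable compact set A ⊆ ℝ, a family (f_t)_{t ∈ A} of holomorphic injective maps on the disk {|z| < e^{-2π}} with f_t(0) = 0 and f_t'(0) = e^{2πit}, commuting pairwise on a neighborhood of 0, and a compact connected set K ⊆ {|z| ≤ e^{-2π}} with 0 ∈ K, K ≠ {0}, ℂ ∖ K connected and f_t(K) = K for every t ∈ A, such that K has strictly positive two-dimensional Lebesgue measure and f_t is non-linearizable for every irrational t ∈ A. -/

import Mathlib

open Complex Metric Set Filter MeasureTheory

noncomputable section

/-- `f` is linearizable at the origin with rotation number `t`. -/
def Linearizable (t : ℝ) (f : ℂ → ℂ) : Prop :=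
  ∃ (h : ℂ → ℂ) (V : Set ℂ), IsOpen V ∧ (0 : ℂ) ∈ V ∧
    DifferentiableOn ℂ h V ∧ Set.InjOn h V ∧ h 0 = 0 ∧
    ∀ᶠ z in nhds (0 : ℂ), f (h z) = h (Complex.exp (2 * Real.pi * Complex.I * t) * z)

section ClosedSubalgebra

variable {X : Type*} [TopologicalSpace X] [CompactSpace X]

/-- A function valued in the slit plane is invertible in every closed algebra containing it. -/
theorem exists_mem_inv_of_mem_slitPlane (S : Subalgebra ℂ C(X, ℂ))
    (hS : IsClosed (S : Set C(X, ℂ))) {f : C(X, ℂ)} (hf : f ∈ S) (h : ∀ x, f x ∈ slitPlane) :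
    ∃ g ∈ S, ∀ x, g x = (f x)⁻¹ := by
  have : IsClosed (S : Set C(X, ℂ)) := hS
  have h0 : (0 : ℂ) ∉ spectrum ℂ (⟨f, hf⟩ : S) := by
    intro h0
    have hb := Subalgebra.spectrum_isBounded_connectedComponentIn S ⟨f, hf⟩ h0
    have hcon : IsPreconnected ((fun t : ℝ => (t : ℂ)) '' Iic 0) :=
      isPreconnected_Iic.image _ continuous_ofReal.continuousOn
    have hsub : (fun t : ℝ => (t : ℂ)) '' Iic 0 ⊆ (spectrum ℂ f)ᶜ := by
      rintro _ ⟨t, ht, rfl⟩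
      rw [ContinuousMap.spectrum_eq_range]
      rintro ⟨x, hx⟩
      have := h x
      rw [hx] at this
      simp only [ofReal_mem_slitPlane] at this
      exact absurd this (not_lt.2 ht)
    have hsub2 := hcon.subset_connectedComponentIn (x := 0) ⟨0, by simp, by simp⟩ hsub
    have hb2 := hb.subset hsub2
    obtain ⟨C, hC⟩ := hb2.exists_norm_le
    have := hC ((-(|C| + 1) : ℝ) : ℂ) ⟨-(|C| + 1),
      by rw [mem_Iic]; linarith [abs_nonneg C], rfl⟩
    rw [norm_real, Real.norm_eq_abs, abs_neg, abs_of_pos (by positivity)] at this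
    linarith [le_abs_self C]
  rw [spectrum.zero_notMem_iff] at h0
  obtain ⟨u, hu⟩ := h0
  refine ⟨((u⁻¹ : Sˣ) : S), Subtype.property _, fun x => ?_⟩
  have h1 : (u : S) * ((u⁻¹ : Sˣ) : S) = 1 := u.mul_inv
  rw [hu] at h1
  have h2 : f x * (((u⁻¹ : Sˣ) : S) : C(X, ℂ)) x = 1 := by
    have := congrArg (fun k : S => (k : C(X, ℂ)) x) h1
    simpa using this
  exact eq_inv_of_mul_eq_one_right h2

/-- A closed algebra of continuous functions is stable under the principal logarithm. -/
theorem exists_mem_log_of_mem_slitPlane (S : Subalgebra ℂ C(X, ℂ))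
    (hS : IsClosed (S : Set C(X, ℂ))) {f : C(X, ℂ)} (hf : f ∈ S) (h : ∀ x, f x ∈ slitPlane) :
    ∃ g ∈ S, ∀ x, g x = Complex.log (f x) := by
  have hstar : ∀ t ∈ Icc (0 : ℝ) 1, ∀ x, 1 + (t : ℂ) * (f x - 1) ∈ slitPlane := by
    intro t ht x
    have := StarConvex.add_smul_mem (x := (1 : ℂ)) (y := f x - 1) (t := t)
      starConvex_one_slitPlane (by simpa using h x) ht.1 ht.2
    simpa using this
  let F : ℝ × X → ℂ := fun p =>
    (1 + (((projIcc (0 : ℝ) 1 zero_le_one p.1 : Icc (0 : ℝ) 1) : ℝ) : ℂ) * (f p.2 - 1))⁻¹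
  have hF : Continuous F := by
    refine Continuous.inv₀ ?_ fun p => slitPlane_ne_zero (hstar _ (Subtype.property _) _)
    have : Continuous fun p : ℝ × X => ((projIcc (0 : ℝ) 1 zero_le_one p.1 : Icc (0 : ℝ) 1) : ℝ) :=
      continuous_subtype_val.comp (continuous_projIcc.comp continuous_fst)
    fun_prop
  let G : C(ℝ, C(X, ℂ)) := ContinuousMap.curry ⟨F, hF⟩
  have hGx : ∀ t ∈ Icc (0 : ℝ) 1, ∀ x, G t x = (1 + (t : ℂ) * (f x - 1))⁻¹ := by
    intro t ht x
    simp [G, F, projIcc_of_mem zero_le_one ht]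
  have hGS : ∀ t ∈ Icc (0 : ℝ) 1, G t ∈ S := by
    intro t ht
    obtain ⟨g, hg, hgx⟩ := exists_mem_inv_of_mem_slitPlane S hS
      (f := 1 + (t : ℂ) • (f - 1)) (S.add_mem S.one_mem (S.smul_mem (S.sub_mem hf S.one_mem) _))
      (fun x => by simpa using hstar t ht x)
    have : G t = g := by
      ext x
      rw [hGx t ht, hgx]
      simp
    rwa [this]
  have hprob : IsProbabilityMeasure (volume.restrict (Ioc (0 : ℝ) 1)) := ⟨by simp⟩
  have hGint : Integrable G (volume.restrict (Ioc (0 : ℝ) 1)) :=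
    (G.continuous.integrableOn_Icc (a := 0) (b := 1)).mono_set Ioc_subset_Icc_self
  have hconv : Convex ℝ (S : Set C(X, ℂ)) := by
    intro a ha b hb s t _ _ _
    have h1 := S.smul_mem ha (s : ℂ)
    have h2 := S.smul_mem hb (t : ℂ)
    have h3 := S.add_mem h1 h2
    have h4 : s • a + t • b = (s : ℂ) • a + (t : ℂ) • b := by ext x; simp
    rwa [h4]
  have hI : ∫ t in Ioc (0 : ℝ) 1, G t ∈ (S : Set C(X, ℂ)) := by
    refine hconv.integral_mem hS ?_ hGint
    refine (ae_restrict_iff' measurableSet_Ioc).2 (Eventually.of_forall fun t ht => ?_)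
    exact hGS t (Ioc_subset_Icc_self ht)
  refine ⟨(f - 1) * ∫ t in Ioc (0 : ℝ) 1, G t, S.mul_mem (S.sub_mem hf S.one_mem) hI,
    fun x => ?_⟩
  have hev : (∫ t in Ioc (0 : ℝ) 1, G t) x = ∫ t in Ioc (0 : ℝ) 1, G t x :=
    ContinuousMap.integral_apply hGint x
  have hlog := Complex.log_eq_integral (z := f x - 1) (by simpa using h x)
  rw [add_sub_cancel] at hlog
  rw [hlog, ContinuousMap.mul_apply, hev, intervalIntegral.integral_of_le zero_le_one]
  congr 1
  refine setIntegral_congr_fun measurableSet_Ioc fun t ht => ?_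
  simpa using hGx t (Ioc_subset_Icc_self ht) x

/-- A closed algebra of continuous functions is stable under the exponential. -/
theorem exists_mem_exp (S : Subalgebra ℂ C(X, ℂ))
    (hS : IsClosed (S : Set C(X, ℂ))) {f : C(X, ℂ)} (hf : f ∈ S) :
    ∃ g ∈ S, ∀ x, g x = Complex.exp (f x) := by
  refine ⟨NormedSpace.exp f, ?_, fun x => ?_⟩
  · refine hS.mem_of_tendsto (NormedSpace.exp_series_hasSum_exp' (𝕂 := ℂ) f)
      (Eventually.of_forall fun s => S.sum_mem fun n _ => S.smul_mem (S.pow_mem hf n) _)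
  · have h := NormedSpace.map_exp (ContinuousMap.evalAlgHom ℂ ℂ x)
      (continuous_eval_const x) f
    rw [Complex.exp_eq_exp_ℂ]
    exact h

end ClosedSubalgebra

section NearIdentity

variable {g : ℂ → ℂ} {r δ : ℝ}

/-- A map with derivative within `δ` of `1` on a disk differs from the identity by a
`δ`-Lipschitz map. -/
theorem norm_sub_sub_le_of_deriv_near_one (hg : DifferentiableOn ℂ g (ball 0 r))
    (hd : ∀ z ∈ ball (0 : ℂ) r, ‖deriv g z - 1‖ ≤ δ) {a b : ℂ} (ha : a ∈ ball (0 : ℂ) r)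
    (hb : b ∈ ball (0 : ℂ) r) : ‖(g a - g b) - (a - b)‖ ≤ δ * ‖a - b‖ := by
  have h1 : ∀ z ∈ ball (0 : ℂ) r, HasDerivWithinAt (fun z => g z - z) (deriv g z - 1)
      (ball (0 : ℂ) r) z := fun z hz =>
    (((hg z hz).differentiableAt (isOpen_ball.mem_nhds hz)).hasDerivAt.sub
      (hasDerivAt_id z)).hasDerivWithinAt
  have := (convex_ball (0 : ℂ) r).norm_image_sub_le_of_norm_hasDerivWithin_le h1 hd hb ha
  have h2 : (g a - g b) - (a - b) = (g a - a) - (g b - b) := by ring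
  rw [h2]
  exact this

theorem le_norm_sub_of_deriv_near_one (hg : DifferentiableOn ℂ g (ball 0 r))
    (hd : ∀ z ∈ ball (0 : ℂ) r, ‖deriv g z - 1‖ ≤ δ) {a b : ℂ} (ha : a ∈ ball (0 : ℂ) r)
    (hb : b ∈ ball (0 : ℂ) r) : (1 - δ) * ‖a - b‖ ≤ ‖g a - g b‖ := by
  have h := norm_sub_sub_le_of_deriv_near_one hg hd ha hb
  have h2 := norm_sub_norm_le (a - b) (g a - g b)
  rw [norm_sub_rev (a - b)] at h2
  linarith

theorem injOn_of_deriv_near_one (hg : DifferentiableOn ℂ g (ball 0 r)) (hδ : δ < 1)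
    (hd : ∀ z ∈ ball (0 : ℂ) r, ‖deriv g z - 1‖ ≤ δ) : InjOn g (ball 0 r) := by
  intro a ha b hb hab
  have h := le_norm_sub_of_deriv_near_one hg hd ha hb
  rw [hab, sub_self, norm_zero] at h
  have : ‖a - b‖ ≤ 0 := by
    by_contra hc
    push Not at hc
    nlinarith
  exact sub_eq_zero.1 (norm_le_zero_iff.1 this)

theorem exists_preimage_of_deriv_near_one (hg : DifferentiableOn ℂ g (ball 0 r)) (hδ : δ < 1)
    (hδ0 : 0 ≤ δ) (hd : ∀ z ∈ ball (0 : ℂ) r, ‖deriv g z - 1‖ ≤ δ) (h0 : g 0 = 0) {w : ℂ}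
    (hw : ‖w‖ < (1 - δ) * r) : ∃ z ∈ ball (0 : ℂ) r, g z = w := by
  have hap : ApproximatesLinearOn g
      ((ContinuousLinearEquiv.refl ℂ ℂ : ℂ ≃L[ℂ] ℂ) : ℂ →L[ℂ] ℂ) (ball 0 r) ⟨δ, hδ0⟩ := by
    intro a ha b hb
    exact norm_sub_sub_le_of_deriv_near_one hg hd ha hb
  have hδ1 : 0 < 1 - δ := by linarith
  let ρ := ‖w‖ / (1 - δ)
  have hρ : ρ < r := by
    rw [div_lt_iff₀ hδ1]; linarith
  have hsub : closedBall (0 : ℂ) ρ ⊆ ball 0 r := closedBall_subset_ball hρ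
  have hs := hap.surjOn_closedBall_of_nonlinearRightInverse
    (ContinuousLinearEquiv.refl ℂ ℂ).toNonlinearRightInverse (ε := ρ) (b := 0)
    (by positivity) hsub
  have hn : ((ContinuousLinearEquiv.refl ℂ ℂ).toNonlinearRightInverse.nnnorm : ℝ) = 1 := by
    show ‖(ContinuousLinearEquiv.refl ℂ ℂ).symm.toContinuousLinearMap‖ = 1
    exact ContinuousLinearMap.norm_id
  have hw' : w ∈ closedBall (g 0)
      (((((ContinuousLinearEquiv.refl ℂ ℂ).toNonlinearRightInverse.nnnorm : ℝ))⁻¹ -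
        ((⟨δ, hδ0⟩ : NNReal) : ℝ)) * ρ) := by
    rw [hn, h0, mem_closedBall_zero_iff]
    show ‖w‖ ≤ (1⁻¹ - δ) * ρ
    rw [inv_one, mul_div_cancel₀ _ hδ1.ne']
  obtain ⟨z, hz, rfl⟩ := hs hw'
  exact ⟨z, hsub hz, rfl⟩

/-- Quantitative inverse function theorem for maps close to the identity on a disk. -/
theorem exists_inverse_of_deriv_near_one (hg : DifferentiableOn ℂ g (ball 0 r)) (hδ : δ < 1)
    (hδ0 : 0 ≤ δ) (hd : ∀ z ∈ ball (0 : ℂ) r, ‖deriv g z - 1‖ ≤ δ) (h0 : g 0 = 0) :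
    ∃ k : ℂ → ℂ, DifferentiableOn ℂ k (ball 0 ((1 - δ) * r)) ∧
      ∀ w ∈ ball (0 : ℂ) ((1 - δ) * r), k w ∈ ball (0 : ℂ) r ∧ g (k w) = w := by
  have hex : ∀ w : ℂ, ∃ z, w ∈ ball (0 : ℂ) ((1 - δ) * r) → z ∈ ball (0 : ℂ) r ∧ g z = w := by
    intro w
    by_cases hw : w ∈ ball (0 : ℂ) ((1 - δ) * r)
    · obtain ⟨z, hz, hzw⟩ := exists_preimage_of_deriv_near_one hg hδ hδ0 hd h0
        (mem_ball_zero_iff.1 hw)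
      exact ⟨z, fun _ => ⟨hz, hzw⟩⟩
    · exact ⟨0, fun h => absurd h hw⟩
  choose k hk using hex
  refine ⟨k, fun w hw => ?_, hk⟩
  have hδ1 : 0 < 1 - δ := by linarith
  have hcont : ContinuousAt k w := by
    rw [Metric.continuousAt_iff]
    intro ε hε
    obtain ⟨η, hη, hsub⟩ := Metric.isOpen_iff.1 isOpen_ball w hw
    refine ⟨min η ((1 - δ) * ε), by positivity, fun {v} hv => ?_⟩
    have hv1 : v ∈ ball (0 : ℂ) ((1 - δ) * r) := hsub (lt_of_lt_of_le hv (min_le_left _ _))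
    have h := le_norm_sub_of_deriv_near_one hg hd (hk v hv1).1 (hk w hw).1
    rw [(hk v hv1).2, (hk w hw).2] at h
    have h3 := lt_of_lt_of_le hv (min_le_right _ _)
    rw [dist_eq_norm] at h3 ⊢
    exact lt_of_mul_lt_mul_left (h.trans_lt h3) hδ1.le
  have hkw := (hk w hw).1
  have hne : deriv g (k w) ≠ 0 := by
    intro h
    have := hd _ hkw
    rw [h] at this
    norm_num at this
    linarith
  have := HasDerivAt.of_local_left_inverse hcont
    ((hg _ hkw).differentiableAt (isOpen_ball.mem_nhds hkw)).hasDerivAt hne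
    (Filter.eventually_of_mem (isOpen_ball.mem_nhds hw) fun v hv => (hk v hv).2)
  exact this.differentiableAt.differentiableWithinAt

end NearIdentity

section LocallyInjective

variable {E : ℂ → ℂ}

theorem exists_uniform_local_inverse (hE : Differentiable ℂ E) (hE' : ∀ z, deriv E z ≠ 0)
    (R : ℝ) {δ : ℝ} (hδ : 0 < δ) :
    ∃ ρ > 0, ρ ≤ δ ∧ ∃ m > 0, ∀ z ∈ closedBall (0 : ℂ) R, InjOn E (ball z ρ) ∧
      ∀ w, ‖w - E z‖ < m → ∃ y ∈ ball z ρ, E y = w := by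
  have hc : Continuous (deriv E) := (hE.contDiff (n := 1)).continuous_deriv le_rfl
  obtain ⟨m0, hm0, hm0'⟩ : ∃ m0 > 0, ∀ z ∈ closedBall (0 : ℂ) R, m0 ≤ ‖deriv E z‖ := by
    rcases (closedBall (0 : ℂ) R).eq_empty_or_nonempty with h | h
    · exact ⟨1, one_pos, by simp [h]⟩
    · obtain ⟨z, _, hz2⟩ := (isCompact_closedBall (0 : ℂ) R).exists_isMinOn h
        hc.norm.continuousOn
      exact ⟨‖deriv E z‖, norm_pos_iff.2 (hE' z), fun y hy => hz2 hy⟩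
  have huc := (isCompact_closedBall (0 : ℂ) (R + 1)).uniformContinuousOn_of_continuous
    hc.continuousOn
  obtain ⟨ρ0, hρ0, hρ0'⟩ := Metric.uniformContinuousOn_iff.1 huc (m0 / 2) (by positivity)
  let ρ := min (min ρ0 1) δ
  have hρ : 0 < ρ := by positivity
  refine ⟨ρ, hρ, min_le_right _ _, m0 * ρ / 2, by positivity, fun z hz => ?_⟩
  have hz0 : deriv E z ≠ 0 := hE' z
  let g : ℂ → ℂ := fun ξ => (E (z + ξ) - E z) / deriv E z
  have hgd : ∀ ξ, HasDerivAt g (deriv E (z + ξ) / deriv E z) ξ := fun ξ => by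
    have h1 : HasDerivAt (fun ξ => E (z + ξ)) (deriv E (z + ξ)) ξ := by
      have := (hE (z + ξ)).hasDerivAt.comp_const_add z ξ
      exact this
    exact (h1.sub_const _).div_const _
  have hg : DifferentiableOn ℂ g (ball 0 ρ) := fun ξ _ =>
    (hgd ξ).differentiableAt.differentiableWithinAt
  have hd : ∀ ξ ∈ ball (0 : ℂ) ρ, ‖deriv g ξ - 1‖ ≤ 1 / 2 := by
    intro ξ hξ
    rw [mem_ball_zero_iff] at hξ
    rw [mem_closedBall_zero_iff] at hz
    have hξ0 : ‖ξ‖ < ρ0 := hξ.trans_le ((min_le_left _ _).trans (min_le_left _ _))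
    have hξ1 : ‖ξ‖ < 1 := hξ.trans_le ((min_le_left _ _).trans (min_le_right _ _))
    have h := hρ0' (z + ξ)
      (by rw [mem_closedBall_zero_iff]; linarith [norm_add_le z ξ]) z
      (by rw [mem_closedBall_zero_iff]; linarith) (by simpa [dist_eq_norm] using hξ0)
    rw [dist_eq_norm] at h
    rw [(hgd ξ).deriv, div_sub_one hz0, norm_div, div_le_iff₀ (norm_pos_iff.2 hz0)]
    have := hm0' z (by rwa [mem_closedBall_zero_iff])
    linarith
  have hgE : ∀ ξ, E (z + ξ) = E z + deriv E z * g ξ := fun ξ => by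
    simp only [g]
    field_simp
    ring
  constructor
  · intro a ha b hb hab
    have ha' : a - z ∈ ball (0 : ℂ) ρ := by rwa [mem_ball_zero_iff, ← dist_eq_norm]
    have hb' : b - z ∈ ball (0 : ℂ) ρ := by rwa [mem_ball_zero_iff, ← dist_eq_norm]
    have := injOn_of_deriv_near_one hg (by norm_num) hd ha' hb' (by simp [g, hab])
    exact sub_left_injective this
  · intro w hw
    have hw' : ‖(w - E z) / deriv E z‖ < (1 - 1 / 2) * ρ := by
      rw [norm_div, div_lt_iff₀ (norm_pos_iff.2 hz0)]
      have := hm0' z hz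
      nlinarith
    obtain ⟨ξ, hξ, hξw⟩ := exists_preimage_of_deriv_near_one hg (by norm_num) (by norm_num) hd
      (by simp [g]) hw'
    refine ⟨z + ξ, by simpa using hξ, ?_⟩
    rw [hgE, hξw]
    field_simp
    ring

/-- Multiplication by `c` close to `1` lifts through `E` to a map close to the identity. -/
theorem exists_lift_rotation (hE : Differentiable ℂ E) (hE' : ∀ z, deriv E z ≠ 0)
    (hE0 : E 0 = 0) (R : ℝ) {δ : ℝ} (hδ : 0 < δ) :
    ∃ η > 0, ∀ c : ℂ, ‖c - 1‖ < η → ∃ φ : ℂ → ℂ, DifferentiableOn ℂ φ (ball 0 R) ∧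
      φ 0 = 0 ∧ ∀ z ∈ ball (0 : ℂ) R, ‖φ z - z‖ < δ ∧ E (φ z) = c * E z := by
  obtain ⟨ρ, hρ, hρδ, m, hm, H⟩ := exists_uniform_local_inverse hE hE' R hδ
  obtain ⟨M, hM⟩ := (isCompact_closedBall (0 : ℂ) R).exists_bound_of_continuousOn
    hE.continuous.continuousOn
  refine ⟨m / (|M| + 1), by positivity, fun c hc => ?_⟩
  have hbd : ∀ z ∈ closedBall (0 : ℂ) R, ‖c * E z - E z‖ < m := by
    intro z hz
    have h1 := hM z hz
    have h2 : c * E z - E z = (c - 1) * E z := by ring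
    rw [h2, norm_mul]
    rw [lt_div_iff₀ (by positivity)] at hc
    have := le_abs_self M
    nlinarith [norm_nonneg (c - 1), norm_nonneg (E z)]
  have hex : ∀ z, ∃ y, (z ∈ closedBall (0 : ℂ) R → y ∈ ball z ρ ∧ E y = c * E z) ∧
      (z = 0 → y = 0) := by
    intro z
    by_cases hz0 : z = 0
    · exact ⟨0, fun _ => ⟨by simp [hz0, hρ], by simp [hz0, hE0]⟩, fun _ => rfl⟩
    · by_cases hz : z ∈ closedBall (0 : ℂ) R
      · obtain ⟨y, hy, hy2⟩ := (H z hz).2 _ (hbd z hz)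
        exact ⟨y, fun _ => ⟨hy, hy2⟩, fun h => absurd h hz0⟩
      · exact ⟨0, fun h => absurd h hz, fun _ => rfl⟩
  choose φ hφ using hex
  refine ⟨φ, fun z hz => ?_, (hφ 0).2 rfl, fun z hz => ?_⟩
  swap
  · have := (hφ z).1 (ball_subset_closedBall hz)
    refine ⟨?_, this.2⟩
    have h1 := this.1
    rw [mem_ball, dist_eq_norm] at h1
    linarith
  obtain ⟨h1, h2⟩ := (hφ z).1 (ball_subset_closedBall hz)
  have hst : HasStrictDerivAt E (deriv E (φ z)) (φ z) :=
    (hE.analyticAt _).hasStrictDerivAt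
  let k := hst.localInverse E _ _ (hE' _)
  have hk : HasStrictDerivAt k (deriv E (φ z))⁻¹ (E (φ z)) := hst.to_localInverse (hE' _)
  have hkz : k (E (φ z)) = φ z :=
    HasStrictFDerivAt.localInverse_apply_image (hst.hasStrictFDerivAt_equiv (hE' _))
  have hkr : ∀ᶠ w in nhds (E (φ z)), E (k w) = w :=
    HasStrictFDerivAt.eventually_right_inverse (hst.hasStrictFDerivAt_equiv (hE' _))
  have hdk : DifferentiableAt ℂ (fun y => k (c * E y)) z := by
    have h3 : DifferentiableAt ℂ k (c * E z) := by rw [← h2]; exact hk.hasDerivAt.differentiableAt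
    exact h3.comp z ((hE z).const_mul c)
  have hcE : ContinuousAt (fun y => c * E y) z := (continuous_const.mul hE.continuous).continuousAt
  have hev1 : ∀ᶠ y in nhds z, E (k (c * E y)) = c * E y := by
    rw [h2] at hkr
    exact hcE.eventually hkr
  have hev2 : ∀ᶠ y in nhds z, k (c * E y) ∈ ball y ρ := by
    have hcont : ContinuousAt (fun y => dist (k (c * E y)) y) z :=
      hdk.continuousAt.dist continuousAt_id
    have hlt : dist (k (c * E z)) z < ρ := by
      rw [← h2, hkz]; exact h1
    exact hcont.eventually (gt_mem_nhds hlt)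
  have hev3 : ∀ᶠ y in nhds z, y ∈ ball (0 : ℂ) R := isOpen_ball.mem_nhds hz
  have heq : φ =ᶠ[nhds z] fun y => k (c * E y) := by
    filter_upwards [hev1, hev2, hev3] with y hy1 hy2 hy3
    have hy4 := ball_subset_closedBall hy3
    obtain ⟨h5, h6⟩ := (hφ y).1 hy4
    exact (H y hy4).1 h5 hy2 (by rw [h6, hy1])
  exact (hdk.congr_of_eventuallyEq heq).differentiableWithinAt

/-- Lifts through a map that is locally injective at `0` are locally unique. -/
theorem eventually_eq_of_comp_eq {u v : ℂ → ℂ} (hE : Differentiable ℂ E) (hE' : deriv E 0 ≠ 0)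
    (hu : ContinuousAt u 0) (hv : ContinuousAt v 0) (hu0 : u 0 = 0) (hv0 : v 0 = 0)
    (h : ∀ᶠ z in nhds 0, E (u z) = E (v z)) : ∀ᶠ z in nhds 0, u z = v z := by
  have hst : HasStrictDerivAt E (deriv E 0) 0 := (hE.analyticAt _).hasStrictDerivAt
  have hl : ∀ᶠ w in nhds (0 : ℂ), hst.localInverse E _ _ hE' (E w) = w :=
    HasStrictFDerivAt.eventually_left_inverse (hst.hasStrictFDerivAt_equiv hE')
  have h1 : ∀ᶠ z in nhds (0 : ℂ), hst.localInverse E _ _ hE' (E (u z)) = u z := by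
    have := hu.tendsto; rw [hu0] at this; exact this.eventually hl
  have h2 : ∀ᶠ z in nhds (0 : ℂ), hst.localInverse E _ _ hE' (E (v z)) = v z := by
    have := hv.tendsto; rw [hv0] at this; exact this.eventually hl
  filter_upwards [h, h1, h2] with z hz hz1 hz2
  rw [← hz1, ← hz2, hz]

theorem eqOn_ball_of_comp_eq {u v : ℂ → ℂ} {r : ℝ} (hr : 0 < r) (hE : Differentiable ℂ E)
    (hE' : deriv E 0 ≠ 0) (hu : DifferentiableOn ℂ u (ball 0 r))
    (hv : DifferentiableOn ℂ v (ball 0 r)) (hu0 : u 0 = 0) (hv0 : v 0 = 0)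
    (h : ∀ z ∈ ball (0 : ℂ) r, E (u z) = E (v z)) : EqOn u v (ball 0 r) := by
  have h0 : ball (0 : ℂ) r ∈ nhds (0 : ℂ) := ball_mem_nhds _ hr
  refine (hu.analyticOnNhd isOpen_ball).eqOn_of_preconnected_of_eventuallyEq
    (hv.analyticOnNhd isOpen_ball) (convex_ball _ _).isPreconnected (mem_ball_self hr) ?_
  exact eventually_eq_of_comp_eq hE hE' (hu.differentiableAt h0).continuousAt
    (hv.differentiableAt h0).continuousAt hu0 hv0 (Filter.eventually_of_mem h0 h)

end LocallyInjective

section SlitDisk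

/-- The Cayley transform from the unit disk to the right half-plane. -/
def cayley (z : ℂ) : ℂ := (1 + z) / (1 - z)

theorem one_sub_ne_zero_of_norm_lt_one {z : ℂ} (hz : ‖z‖ < 1) : 1 - z ≠ 0 := by
  intro h
  have : z = 1 := (sub_eq_zero.1 h).symm
  rw [this, norm_one] at hz
  exact lt_irrefl _ hz

theorem cayley_re_pos {z : ℂ} (hz : ‖z‖ < 1) : 0 < (cayley z).re := by
  have hne := one_sub_ne_zero_of_norm_lt_one hz
  have h1 : 0 < normSq (1 - z) := normSq_pos.2 hne
  have h2 : normSq z < 1 := by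
    rw [normSq_eq_norm_sq]
    nlinarith [norm_nonneg z]
  rw [normSq_apply] at h2
  rw [cayley, div_re, ← add_div]
  apply div_pos _ h1
  simp only [add_re, one_re, sub_re, add_im, one_im, sub_im]
  nlinarith

theorem add_one_ne_zero_of_re_pos {x : ℂ} (hx : 0 < x.re) : x + 1 ≠ 0 := by
  intro h
  have := congrArg re h
  simp only [add_re, one_re, zero_re] at this
  linarith

theorem cayley_sub_one_div {z : ℂ} (hz : ‖z‖ < 1) : (cayley z - 1) / (cayley z + 1) = z := by
  have hne := one_sub_ne_zero_of_norm_lt_one hz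
  have h2 := add_one_ne_zero_of_re_pos (cayley_re_pos hz)
  rw [div_eq_iff h2, cayley]
  field_simp
  ring

theorem norm_sub_one_div_lt_one {x : ℂ} (hx : 0 < x.re) : ‖(x - 1) / (x + 1)‖ < 1 := by
  have h2 := add_one_ne_zero_of_re_pos hx
  rw [norm_div, div_lt_one (norm_pos_iff.2 h2), ← sq_lt_sq₀ (norm_nonneg _) (norm_nonneg _),
    ← normSq_eq_norm_sq, ← normSq_eq_norm_sq, normSq_apply, normSq_apply]
  simp only [sub_re, one_re, sub_im, one_im, add_re, add_im]
  nlinarith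

theorem cayley_sub_one_div_add_one {x : ℂ} (hx : 0 < x.re) :
    cayley ((x - 1) / (x + 1)) = x := by
  have h2 := add_one_ne_zero_of_re_pos hx
  rw [cayley]
  have h3 : 1 - (x - 1) / (x + 1) = 2 / (x + 1) := by field_simp; ring
  rw [h3]
  field_simp
  ring

theorem eq_of_sq_eq_of_re_pos {a b : ℂ} (ha : 0 < a.re) (hb : 0 < b.re) (h : a ^ 2 = b ^ 2) :
    a = b := by
  rcases sq_eq_sq_iff_eq_or_eq_neg.1 h with h | h
  · exact h
  · rw [h, neg_re] at ha
    linarith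

theorem mul_sq_add_mem_slitPlane {x : ℂ} (hx : 0 < x.re) {c d : ℝ} (hc : 0 < c) (hd : 0 ≤ d) :
    (c : ℂ) * x ^ 2 + d ∈ slitPlane := by
  rw [mem_slitPlane_iff]
  by_cases h : x.im = 0
  · left
    have : ((c : ℂ) * x ^ 2 + d).re = c * (x.re * x.re - x.im * x.im) + d := by
      simp [pow_two]
    rw [this, h]
    have := mul_pos hc (mul_pos hx hx)
    linarith
  · right
    have : ((c : ℂ) * x ^ 2 + d).im = c * (2 * (x.re * x.im)) := by
      simp only [pow_two, add_im, mul_im, mul_re, ofReal_re, ofReal_im]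
      ring
    rw [this]
    positivity

theorem re_exp_log_div_two_pos {w : ℂ} (hw : w ∈ slitPlane) :
    0 < (Complex.exp (Complex.log w / 2)).re := by
  rw [exp_re]
  refine mul_pos (Real.exp_pos _) (Real.cos_pos_of_mem_Ioo ?_)
  have him : (Complex.log w / 2).im = w.arg / 2 := by
    rw [show (2 : ℂ) = ((2 : ℝ) : ℂ) by norm_num, div_ofReal_im, log_im]
  rw [him]
  have h2 := neg_pi_lt_arg w
  have h3 : w.arg < Real.pi := lt_of_le_of_ne (arg_le_pi w) (slitPlane_arg_ne_pi hw)
  constructor <;> linarith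

theorem exp_log_div_two_sq {w : ℂ} (hw : w ≠ 0) : Complex.exp (Complex.log w / 2) ^ 2 = w := by
  rw [← Complex.exp_nat_mul]
  rw [show ((2 : ℕ) : ℂ) * (Complex.log w / 2) = Complex.log w by push_cast; ring]
  exact exp_log hw

/-- The square root of `(1 - t²) S² + t²`, where `S` is the Cayley transform: this conjugates the
half-plane to the half-plane slit along `(0, t]`. -/
def slitRoot (t : ℝ) (z : ℂ) : ℂ :=
  Complex.exp (Complex.log (((1 - t ^ 2 : ℝ) : ℂ) * cayley z ^ 2 + (t ^ 2 : ℝ)) / 2)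

/-- The exponent defining `slitMap`. -/
def slitExponent (t : ℝ) (N : ℕ) (z : ℂ) : ℂ :=
  (Complex.log ((1 - t ^ 2 : ℝ) : ℂ) +
    2 * (Complex.log (cayley z + 1) - Complex.log (slitRoot t z + 1))) / N

/-- The conformal map from the unit disk onto the unit disk minus `N` symmetric radial slits. -/
def slitMap (t : ℝ) (N : ℕ) (z : ℂ) : ℂ := z * Complex.exp (slitExponent t N (z ^ N))

variable {t : ℝ} {N : ℕ} {z : ℂ}

theorem one_sub_sq_pos (ht : t ∈ Ioo (0 : ℝ) 1) : 0 < 1 - t ^ 2 := by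
  nlinarith [ht.1, ht.2]

theorem slitRoot_arg_mem (ht : t ∈ Ioo (0 : ℝ) 1) (hz : ‖z‖ < 1) :
    ((1 - t ^ 2 : ℝ) : ℂ) * cayley z ^ 2 + (t ^ 2 : ℝ) ∈ slitPlane :=
  mul_sq_add_mem_slitPlane (cayley_re_pos hz) (one_sub_sq_pos ht) (sq_nonneg t)

theorem slitRoot_re_pos (ht : t ∈ Ioo (0 : ℝ) 1) (hz : ‖z‖ < 1) : 0 < (slitRoot t z).re :=
  re_exp_log_div_two_pos (slitRoot_arg_mem ht hz)

theorem slitRoot_sq (ht : t ∈ Ioo (0 : ℝ) 1) (hz : ‖z‖ < 1) :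
    slitRoot t z ^ 2 = ((1 - t ^ 2 : ℝ) : ℂ) * cayley z ^ 2 + (t ^ 2 : ℝ) :=
  exp_log_div_two_sq (slitPlane_ne_zero (slitRoot_arg_mem ht hz))

theorem mem_slitPlane_of_re_pos {x : ℂ} (hx : 0 < x.re) : x ∈ slitPlane :=
  mem_slitPlane_iff.2 (Or.inl hx)

theorem add_one_re_pos {x : ℂ} (hx : 0 < x.re) : 0 < (x + 1).re := by
  rw [add_re, one_re]; linarith

theorem norm_pow_lt_one (hN : N ≠ 0) (hz : ‖z‖ < 1) : ‖z ^ N‖ < 1 := by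
  rw [norm_pow]
  exact pow_lt_one₀ (norm_nonneg _) hz hN

theorem slitMap_pow (ht : t ∈ Ioo (0 : ℝ) 1) (hN : N ≠ 0) (hz : ‖z‖ < 1) :
    slitMap t N z ^ N = (slitRoot t (z ^ N) - 1) / (slitRoot t (z ^ N) + 1) := by
  have hzN := norm_pow_lt_one hN hz
  have hN' : (N : ℂ) ≠ 0 := by exact_mod_cast hN
  rw [slitMap, mul_pow, ← Complex.exp_nat_mul, slitExponent, mul_div_cancel₀ _ hN']
  generalize z ^ N = u at hzN
  have hS := add_one_ne_zero_of_re_pos (cayley_re_pos hzN)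
  have hX := add_one_ne_zero_of_re_pos (slitRoot_re_pos ht hzN)
  have hsq := slitRoot_sq ht hzN
  have hc : ((1 - t ^ 2 : ℝ) : ℂ) ≠ 0 := by exact_mod_cast (one_sub_sq_pos ht).ne'
  rw [Complex.exp_add, exp_log hc, two_mul, Complex.exp_add, Complex.exp_sub, exp_log hS,
    exp_log hX]
  have hu : u * (cayley u + 1) = cayley u - 1 := by
    have := cayley_sub_one_div hzN
    rw [div_eq_iff hS] at this
    exact this.symm
  field_simp
  push_cast at hsq ⊢
  linear_combination (1 - (t : ℂ) ^ 2) * (cayley u + 1) * hu - hsq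

theorem slitMap_zero : slitMap t N 0 = 0 := by simp [slitMap]

theorem norm_slitMap_lt_one (ht : t ∈ Ioo (0 : ℝ) 1) (hN : N ≠ 0) (hz : ‖z‖ < 1) :
    ‖slitMap t N z‖ < 1 := by
  have h : ‖slitMap t N z ^ N‖ < 1 := by
    rw [slitMap_pow ht hN hz]
    exact norm_sub_one_div_lt_one (slitRoot_re_pos ht (norm_pow_lt_one hN hz))
  rw [norm_pow] at h
  by_contra hc
  push Not at hc
  exact absurd h (not_lt.2 (one_le_pow₀ hc))

theorem slitMap_mul_root {ω : ℂ} (hω : ω ^ N = 1) : slitMap t N (ω * z) = ω * slitMap t N z := by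
  simp only [slitMap, mul_pow, hω, one_mul]
  ring

theorem slitMap_pow_ne (ht : t ∈ Ioo (0 : ℝ) 1) (hN : N ≠ 0) (hz : ‖z‖ < 1) :
    slitMap t N z ^ N ≠ ((t : ℂ) - 1) / (t + 1) := by
  intro h
  have hzN := norm_pow_lt_one hN hz
  rw [slitMap_pow ht hN hz] at h
  have h1 := congrArg cayley h
  rw [cayley_sub_one_div_add_one (slitRoot_re_pos ht hzN),
    cayley_sub_one_div_add_one (by simpa using ht.1)] at h1
  have hsq := slitRoot_sq ht hzN
  rw [h1] at hsq
  have hc : ((1 - t ^ 2 : ℝ) : ℂ) ≠ 0 := by exact_mod_cast (one_sub_sq_pos ht).ne'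
  have : ((1 - t ^ 2 : ℝ) : ℂ) * cayley (z ^ N) ^ 2 = 0 := by
    push_cast at hsq ⊢
    linear_combination -hsq
  rcases mul_eq_zero.1 this with h | h
  · exact hc h
  · exact Complex.ne_zero_of_re_pos (cayley_re_pos hzN) (by simpa using h)

theorem exists_slitMap_eq (ht : t ∈ Ioo (0 : ℝ) 1) (hN : N ≠ 0) {w : ℂ} (hw : ‖w‖ < 1)
    (hwN : (w ^ N).im ≠ 0) : ∃ z ∈ ball (0 : ℂ) 1, slitMap t N z = w := by
  have hu := norm_pow_lt_one hN hw
  have hx := cayley_re_pos hu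
  set x := cayley (w ^ N) with hxdef
  have hxim : x.im ≠ 0 := by
    intro h
    apply hwN
    have h1 : x = (x.re : ℂ) := by
      apply Complex.ext <;> simp [h]
    rw [← cayley_sub_one_div hu, ← hxdef, h1, ← ofReal_one, ← ofReal_sub, ← ofReal_add,
      ← ofReal_div, ofReal_im]
  have hc0 : (0 : ℝ) < 1 - t ^ 2 := one_sub_sq_pos ht
  have hc : ((1 - t ^ 2 : ℝ) : ℂ) ≠ 0 := by exact_mod_cast hc0.ne'
  let v : ℂ := (x ^ 2 - (t ^ 2 : ℝ)) / ((1 - t ^ 2 : ℝ) : ℂ)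
  have hv : v ∈ slitPlane := by
    rw [mem_slitPlane_iff]
    right
    have : v.im = (2 * (x.re * x.im)) / (1 - t ^ 2) := by
      simp only [v, div_ofReal_im]
      congr 1
      rw [sub_im, ofReal_im, pow_two, mul_im]
      ring
    rw [this]
    have := hx.ne'
    have := hc0.ne'
    positivity
  let S : ℂ := Complex.exp (Complex.log v / 2)
  have hS : 0 < S.re := re_exp_log_div_two_pos hv
  have hSv : S ^ 2 = v := exp_log_div_two_sq (slitPlane_ne_zero hv)
  let u : ℂ := (S - 1) / (S + 1)
  have hu1 : ‖u‖ < 1 := norm_sub_one_div_lt_one hS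
  have hcu : cayley u = S := cayley_sub_one_div_add_one hS
  obtain ⟨z0, hz0⟩ := IsAlgClosed.exists_pow_nat_eq u (Nat.pos_of_ne_zero hN)
  have hz0' : ‖z0‖ < 1 := by
    by_contra h
    push Not at h
    have := one_le_pow₀ h (n := N)
    rw [← norm_pow, hz0] at this
    linarith
  have hroot : slitRoot t (z0 ^ N) = x := by
    refine eq_of_sq_eq_of_re_pos (slitRoot_re_pos ht (norm_pow_lt_one hN hz0')) hx ?_
    rw [slitRoot_sq ht (norm_pow_lt_one hN hz0'), hz0, hcu, hSv]
    simp only [v]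
    field_simp
    ring
  have hpow : slitMap t N z0 ^ N = w ^ N := by
    rw [slitMap_pow ht hN hz0', hroot, hxdef, cayley_sub_one_div hu]
  have hw0 : w ≠ 0 := by
    rintro rfl
    apply hwN
    simp [hN]
  have hp0 : slitMap t N z0 ≠ 0 := by
    intro h
    rw [h, zero_pow hN] at hpow
    exact pow_ne_zero N hw0 hpow.symm
  have hω : (w / slitMap t N z0) ^ N = 1 := by
    rw [div_pow, hpow, div_self (pow_ne_zero N hw0)]
  refine ⟨w / slitMap t N z0 * z0, ?_, ?_⟩
  · have h1 : ‖w / slitMap t N z0‖ = 1 := norm_eq_one_of_pow_eq_one hω hN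
    rw [mem_ball_zero_iff, norm_mul, h1, one_mul]
    exact hz0'
  · rw [slitMap_mul_root hω, div_mul_cancel₀ _ hp0]

theorem hasDerivAt_cayley (hz : ‖z‖ < 1) : HasDerivAt cayley ((cayley z + 1) ^ 2 / 2) z := by
  have hne := one_sub_ne_zero_of_norm_lt_one hz
  have h := ((hasDerivAt_id z).const_add 1).div ((hasDerivAt_id z).const_sub 1) hne
  refine h.congr_deriv ?_
  simp only [id, cayley]
  field_simp
  ring

theorem hasDerivAt_slitRoot (ht : t ∈ Ioo (0 : ℝ) 1) (hz : ‖z‖ < 1) :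
    HasDerivAt (slitRoot t)
      (((1 - t ^ 2 : ℝ) : ℂ) * cayley z * ((cayley z + 1) ^ 2 / 2) / slitRoot t z) z := by
  have h1 := (((hasDerivAt_cayley hz).pow 2).const_mul ((1 - t ^ 2 : ℝ) : ℂ)).add_const
    (((t ^ 2 : ℝ) : ℂ))
  have h2 := ((h1.clog (slitRoot_arg_mem ht hz)).div_const 2).cexp
  refine h2.congr_deriv ?_
  have hsq := slitRoot_sq ht hz
  have hne := Complex.ne_zero_of_re_pos (slitRoot_re_pos ht hz)
  simp only [Pi.pow_apply]
  change slitRoot t z * _ = _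
  rw [← hsq, show 2 - 1 = 1 from rfl, pow_one]
  push_cast
  field_simp

theorem hasDerivAt_slitMap (ht : t ∈ Ioo (0 : ℝ) 1) (hN : N ≠ 0) (hz : ‖z‖ < 1) :
    HasDerivAt (slitMap t N) (Complex.exp (slitExponent t N (z ^ N) +
      Complex.log (cayley (z ^ N)) - Complex.log (slitRoot t (z ^ N)))) z := by
  have hzN := norm_pow_lt_one hN hz
  have hN' : (N : ℂ) ≠ 0 := by exact_mod_cast hN
  have hS := cayley_re_pos hzN
  have hX := slitRoot_re_pos ht hzN
  have hL : HasDerivAt (slitExponent t N) _ (z ^ N) :=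
    (((((hasDerivAt_cayley hzN).add_const 1).clog
      (mem_slitPlane_of_re_pos (add_one_re_pos hS))).sub
      (((hasDerivAt_slitRoot ht hzN).add_const 1).clog
      (mem_slitPlane_of_re_pos (add_one_re_pos hX)))).const_mul 2).const_add
      (Complex.log ((1 - t ^ 2 : ℝ) : ℂ)) |>.div_const (N : ℂ)
  have hP := (hasDerivAt_id z).mul ((hL.comp z (hasDerivAt_pow N z)).cexp)
  refine hP.congr_deriv ?_
  have hsq := slitRoot_sq ht hzN
  have hu := cayley_sub_one_div hzN
  have hS0 := Complex.ne_zero_of_re_pos hS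
  have hX0 := Complex.ne_zero_of_re_pos hX
  have hS1 := add_one_ne_zero_of_re_pos hS
  have hX1 := add_one_ne_zero_of_re_pos hX
  rw [Complex.exp_sub, Complex.exp_add, exp_log hS0, exp_log hX0]
  simp only [id, Function.comp]
  have hzz : z * z ^ (N - 1) = z ^ N := by
    rw [← pow_succ', Nat.sub_add_cancel (Nat.one_le_iff_ne_zero.2 hN)]
  generalize Complex.exp (slitExponent t N (z ^ N)) = e
  have hu2 : z * z ^ (N - 1) = (cayley (z ^ N) - 1) / (cayley (z ^ N) + 1) := by
    rw [hzz, hu]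
  generalize slitRoot t (z ^ N) = x at *
  generalize cayley (z ^ N) = s at *
  push_cast at hsq ⊢
  have key : 1 * e + z * (e * (2 * ((s + 1) ^ 2 / 2 / (s + 1) -
      (1 - (t : ℂ) ^ 2) * s * ((s + 1) ^ 2 / 2) / x / (x + 1)) / N * (N * z ^ (N - 1)))) =
      e * (1 + (z * z ^ (N - 1)) * (2 * ((s + 1) ^ 2 / 2 / (s + 1) -
      (1 - (t : ℂ) ^ 2) * s * ((s + 1) ^ 2 / 2) / x / (x + 1)))) := by
    field_simp
  have hbr : 1 + (s - 1) / (s + 1) * (2 * ((s + 1) ^ 2 / 2 / (s + 1) -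
      (1 - (t : ℂ) ^ 2) * s * ((s + 1) ^ 2 / 2) / x / (x + 1))) = s / x := by
    field_simp
    linear_combination s * hsq
  rw [key, hu2, hbr, mul_div_assoc]

end SlitDisk

section Approximation

theorem exists_polynomial_norm_sub_lt_of_mem {X : Type*} [TopologicalSpace X] [CompactSpace X]
    {U f : C(X, ℂ)} (hf : f ∈ (Algebra.adjoin ℂ {U}).topologicalClosure) {δ : ℝ} (hδ : 0 < δ) :
    ∃ Q : Polynomial ℂ, ∀ x, ‖Q.eval (U x) - f x‖ < δ := by
  rw [← SetLike.mem_coe, Subalgebra.topologicalClosure_coe, Metric.mem_closure_iff] at hf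
  obtain ⟨p, hp, hd⟩ := hf δ hδ
  rw [SetLike.mem_coe, Algebra.adjoin_singleton_eq_range_aeval] at hp
  obtain ⟨Q, rfl⟩ := hp
  refine ⟨Q, fun x => ?_⟩
  have h1 := ContinuousMap.dist_apply_le_dist (f := f) (g := Polynomial.aeval U Q) x
  have h2 : (Polynomial.aeval U Q : C(X, ℂ)) x = Q.eval (U x) := by simp
  rw [← h2, ← dist_eq_norm, dist_comm]
  exact lt_of_le_of_lt h1 hd

variable {t : ℝ} {N : ℕ}

theorem exists_polynomial_approx_slit (ht : t ∈ Ioo (0 : ℝ) 1) {r δ : ℝ} (hr : r < 1)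
    (hδ : 0 < δ) : ∃ Q : Polynomial ℂ, ∀ z ∈ closedBall (0 : ℂ) r,
      ‖Q.eval ((slitRoot t z - 1) / (slitRoot t z + 1)) - (slitExponent t N z +
        Complex.log (cayley z) - Complex.log (slitRoot t z))‖ < δ := by
  have hlt : ∀ z : closedBall (0 : ℂ) r, ‖(z : ℂ)‖ < 1 := fun z =>
    lt_of_le_of_lt (mem_closedBall_zero_iff.1 z.2) hr
  have hXre : ∀ z : closedBall (0 : ℂ) r, 0 < (slitRoot t z).re := fun z =>
    slitRoot_re_pos ht (hlt z)
  have hXc : Continuous fun z : closedBall (0 : ℂ) r => slitRoot t z :=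
    continuous_iff_continuousAt.2 fun z =>
      (hasDerivAt_slitRoot ht (hlt z)).continuousAt.comp continuousAt_subtype_val
  let U : C(closedBall (0 : ℂ) r, ℂ) :=
    ⟨fun z => (slitRoot t z - 1) / (slitRoot t z + 1),
      (hXc.sub continuous_const).div (hXc.add continuous_const)
        fun z => add_one_ne_zero_of_re_pos (hXre z)⟩
  set S := (Algebra.adjoin ℂ {U}).topologicalClosure with hSdef
  have hS : IsClosed (S : Set C(closedBall (0 : ℂ) r, ℂ)) :=
    Subalgebra.isClosed_topologicalClosure _
  have hUS : U ∈ S := Subalgebra.le_topologicalClosure _ (Algebra.self_mem_adjoin_singleton ℂ U)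
  have hconst : ∀ c : ℂ, algebraMap ℂ C(closedBall (0 : ℂ) r, ℂ) c ∈ S := fun c =>
    S.algebraMap_mem c
  have hconst_apply : ∀ (c : ℂ) (z : closedBall (0 : ℂ) r),
      algebraMap ℂ C(closedBall (0 : ℂ) r, ℂ) c z = c := fun c z => rfl
  obtain ⟨G, hGS, hG⟩ := exists_mem_inv_of_mem_slitPlane S hS (S.sub_mem S.one_mem hUS)
    (fun x => by
      refine mem_slitPlane_of_re_pos ?_
      have h1 : ‖U x‖ < 1 := norm_sub_one_div_lt_one (hXre x)
      have h2 := (abs_le.1 (abs_re_le_norm (U x))).2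
      simp only [ContinuousMap.sub_apply, ContinuousMap.one_apply, sub_re, one_re]
      linarith)
  obtain ⟨X, hXS, hX⟩ : ∃ X ∈ S, ∀ z : closedBall (0 : ℂ) r, X z = slitRoot t z := by
    refine ⟨(2 : ℂ) • G - 1, S.sub_mem (S.smul_mem hGS 2) S.one_mem, fun z => ?_⟩
    have hne := add_one_ne_zero_of_re_pos (hXre z)
    simp only [ContinuousMap.sub_apply, ContinuousMap.smul_apply, ContinuousMap.one_apply, hG,
      smul_eq_mul]
    have : 1 - U z = 2 / (slitRoot t z + 1) := by
      change 1 - (slitRoot t z - 1) / (slitRoot t z + 1) = _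
      field_simp
      ring
    rw [this]
    field_simp
    ring
  have hc : ((1 - t ^ 2 : ℝ) : ℂ) ≠ 0 := by exact_mod_cast (one_sub_sq_pos ht).ne'
  obtain ⟨Y, hYS, hY⟩ : ∃ Y ∈ S, ∀ z : closedBall (0 : ℂ) r, Y z = cayley z ^ 2 := by
    refine ⟨((1 - t ^ 2 : ℝ) : ℂ)⁻¹ • (X ^ 2 - algebraMap ℂ _ ((t ^ 2 : ℝ) : ℂ)),
      S.smul_mem (S.sub_mem (S.pow_mem hXS 2) (hconst _)) _, fun z => ?_⟩
    simp only [ContinuousMap.sub_apply, ContinuousMap.smul_apply, ContinuousMap.pow_apply, hX,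
      smul_eq_mul, hconst_apply, slitRoot_sq ht (hlt z)]
    field_simp
    ring
  have hCre : ∀ z : closedBall (0 : ℂ) r, 0 < (cayley z).re := fun z => cayley_re_pos (hlt z)
  have hYmem : ∀ z, Y z ∈ slitPlane := fun z => by
    have := mul_sq_add_mem_slitPlane (hCre z) one_pos le_rfl
    rw [hY]
    simpa using this
  obtain ⟨LY, hLYS, hLY⟩ := exists_mem_log_of_mem_slitPlane S hS hYS hYmem
  obtain ⟨C, hCS, hC'⟩ := exists_mem_exp S hS (S.smul_mem hLYS (2⁻¹ : ℂ))
  have hC : ∀ z : closedBall (0 : ℂ) r, C z = cayley z := fun z => by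
    rw [hC', ContinuousMap.smul_apply, hLY, smul_eq_mul, inv_mul_eq_div]
    refine eq_of_sq_eq_of_re_pos (re_exp_log_div_two_pos (hYmem z)) (hCre z) ?_
    rw [exp_log_div_two_sq (slitPlane_ne_zero (hYmem z)), hY]
  obtain ⟨L1, h1S, h1⟩ := exists_mem_log_of_mem_slitPlane S hS hCS fun z => by
    rw [hC]; exact mem_slitPlane_of_re_pos (hCre z)
  obtain ⟨L2, h2S, h2⟩ := exists_mem_log_of_mem_slitPlane S hS (S.add_mem hCS S.one_mem) fun z => by
    rw [ContinuousMap.add_apply, ContinuousMap.one_apply, hC]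
    exact mem_slitPlane_of_re_pos (add_one_re_pos (hCre z))
  obtain ⟨L3, h3S, h3⟩ := exists_mem_log_of_mem_slitPlane S hS hXS fun z => by
    rw [hX]; exact mem_slitPlane_of_re_pos (hXre z)
  obtain ⟨L4, h4S, h4⟩ := exists_mem_log_of_mem_slitPlane S hS (S.add_mem hXS S.one_mem) fun z => by
    rw [ContinuousMap.add_apply, ContinuousMap.one_apply, hX]
    exact mem_slitPlane_of_re_pos (add_one_re_pos (hXre z))
  have hF : (N : ℂ)⁻¹ • (algebraMap ℂ _ (Complex.log ((1 - t ^ 2 : ℝ) : ℂ)) +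
      (2 : ℂ) • (L2 - L4)) + L1 - L3 ∈ S :=
    S.sub_mem (S.add_mem (S.smul_mem (S.add_mem (hconst _) (S.smul_mem (S.sub_mem h2S h4S) _)) _)
      h1S) h3S
  obtain ⟨Q, hQ⟩ := exists_polynomial_norm_sub_lt_of_mem hF hδ
  refine ⟨Q, fun z hz => ?_⟩
  have := hQ ⟨z, hz⟩
  simp only [ContinuousMap.sub_apply, ContinuousMap.add_apply, ContinuousMap.smul_apply, h1, h2,
    h3, h4, hC, hX, ContinuousMap.one_apply, hconst_apply, smul_eq_mul] at this
  rw [inv_mul_eq_div] at this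
  exact this

end Approximation

section Perturbation

theorem Complex.volume_pow_im_eq_zero {N : ℕ} (hN : N ≠ 0) :
    volume {w : ℂ | (w ^ N).im = 0} = 0 := by
  have hsub : {w : ℂ | (w ^ N).im = 0} ⊆
      ⋃ ω ∈ ((Polynomial.nthRoots (2 * N) (1 : ℂ)).toFinset : Set ℂ),
        ((ℝ ∙ ω : Submodule ℝ ℂ) : Set ℂ) := by
    intro w hw
    have hN2 : 0 < 2 * N := by lia
    simp only [mem_iUnion, Multiset.mem_toFinset, Polynomial.mem_nthRoots hN2,
      SetLike.mem_coe, exists_prop]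
    by_cases h0 : w = 0
    · exact ⟨1, one_pow _, by simp [h0]⟩
    have hn : (‖w‖ : ℂ) ≠ 0 := by simpa using h0
    refine ⟨w / ‖w‖, ?_, Submodule.mem_span_singleton.2 ⟨‖w‖, ?_⟩⟩
    · have h1 : w ^ N = ((w ^ N).re : ℂ) := by
        apply Complex.ext
        · simp
        · simpa using hw
      have h2 : ((w ^ N).re) ^ 2 = ‖w‖ ^ (2 * N) := by
        have := congrArg norm h1
        rw [norm_real, norm_pow] at this
        rw [mul_comm, pow_mul, this, Real.norm_eq_abs, sq_abs]
      rw [div_pow, div_eq_one_iff_eq (pow_ne_zero _ hn), mul_comm, pow_mul, h1, mul_comm N 2]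
      exact_mod_cast h2
    · rw [real_smul, mul_div_cancel₀ _ hn]
  refine measure_mono_null hsub ((measure_biUnion_null_iff (Finset.countable_toSet _)).2 ?_)
  intro ω _
  refine Measure.addHaar_submodule volume _ fun htop => ?_
  have h1 : Module.finrank ℝ (ℝ ∙ ω : Submodule ℝ ℂ) ≤ 1 :=
    (finrank_span_le_card (R := ℝ) ({ω} : Set ℂ)).trans_eq (by simp)
  rw [htop, finrank_top, Complex.finrank_real_complex] at h1
  lia

theorem exists_entire_primitive {f : ℂ → ℂ} (hf : Differentiable ℂ f) :
    ∃ g : ℂ → ℂ, g 0 = 0 ∧ ∀ z, HasDerivAt g (f z) z := by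
  obtain ⟨g, hg0, hg⟩ := hf.isExactOn_univ.with_val_at 0 0
  exact ⟨g, hg0, fun z => hg z (mem_univ z)⟩

variable {t : ℝ} {N : ℕ}

theorem exists_volume_diff_slitMap_lt (ht : t ∈ Ioo (0 : ℝ) 1) (hN : N ≠ 0) {ε : ENNReal}
    (hε : 0 < ε) : ∃ r ∈ Ioo (0 : ℝ) 1,
      volume (ball (0 : ℂ) 1 \ slitMap t N '' closedBall 0 r) < ε := by
  obtain ⟨r, hmono, hr, hlim⟩ := exists_seq_strictMono_tendsto' (zero_lt_one (α := ℝ))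
  let s : ℕ → Set ℂ := fun n => ball 0 1 \ slitMap t N '' closedBall 0 (r n)
  have hcont : ContinuousOn (slitMap t N) (ball 0 1) := fun z hz =>
    (hasDerivAt_slitMap ht hN (mem_ball_zero_iff.1 hz)).continuousAt.continuousWithinAt
  have hmeas : ∀ n, NullMeasurableSet (s n) volume := fun n =>
    (measurableSet_ball.diff ((isCompact_closedBall 0 (r n)).image_of_continuousOn
      (hcont.mono (closedBall_subset_ball (hr n).2))).isClosed.measurableSet).nullMeasurableSet
  have hanti : Antitone s := fun m n hmn =>
    sdiff_subset_sdiff_right (image_mono (closedBall_subset_closedBall (hmono.monotone hmn)))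
  have hfin : ∃ n, volume (s n) ≠ ⊤ :=
    ⟨0, ((measure_mono sdiff_subset).trans_lt measure_ball_lt_top).ne⟩
  have hlim2 := tendsto_measure_iInter_atTop hmeas hanti hfin
  have hnull : volume (⋂ n, s n) = 0 := by
    refine measure_mono_null (fun w hw => ?_) (Complex.volume_pow_im_eq_zero hN)
    by_contra hc
    rw [mem_iInter] at hw
    obtain ⟨z, hz, hzw⟩ := exists_slitMap_eq ht hN (mem_ball_zero_iff.1 (hw 0).1) hc
    rw [mem_ball_zero_iff] at hz
    obtain ⟨n, hn⟩ := (hlim.eventually (lt_mem_nhds hz)).exists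
    exact (hw n).2 ⟨z, mem_closedBall_zero_iff.2 hn.le, hzw⟩
  rw [hnull] at hlim2
  obtain ⟨n, hn⟩ := (hlim2.eventually (gt_mem_nhds hε)).exists
  exact ⟨r n, hr n, hn⟩

/-- An entire locally injective map commuting with the rotations of order `N`, together with an
inverse branch whose image of the closed unit disk has almost full area in the unit disk but misses
a point close to the origin. -/
theorem exists_entire_map_with_inverse_branch (hN : N ≠ 0) {η : ℝ} (hη : 0 < η) {ε : ENNReal}
    (hε : 0 < ε) : ∃ (e h : ℂ → ℂ) (τ : ℝ), Differentiable ℂ e ∧ (∀ z, deriv e z ≠ 0) ∧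
      e 0 = 0 ∧ (∀ ω w, ω ^ N = 1 → e (ω * w) = ω * e w) ∧ 1 < τ ∧
      DifferentiableOn ℂ h (ball 0 τ) ∧ h 0 = 0 ∧ MapsTo h (ball 0 τ) (ball 0 1) ∧
      (∀ ζ ∈ ball 0 τ, e (h ζ) = ζ) ∧ volume (ball 0 1 \ h '' closedBall 0 1) < ε ∧
      ∃ w ∈ ball (0 : ℂ) 1, ‖w‖ < η ∧ w ∉ h '' closedBall 0 1 := by
  obtain ⟨t, ht, htη⟩ : ∃ t ∈ Ioo (0 : ℝ) 1, 1 - t < (min η 1) ^ N := by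
    have h1 : 0 < min η 1 ^ N := by positivity
    have h2 : min η 1 ^ N ≤ 1 := pow_le_one₀ (by positivity) (min_le_right _ _)
    exact ⟨1 - min η 1 ^ N / 2, ⟨by linarith, by linarith⟩, by linarith⟩
  obtain ⟨r1, hr1, hvol⟩ := exists_volume_diff_slitMap_lt ht hN hε
  obtain ⟨r2, hr12, hr2⟩ := exists_between hr1.2
  obtain ⟨δ, hδ0, hδ1, hδ⟩ : ∃ δ : ℝ, 0 < δ ∧ δ < 1 ∧ (1 + δ) * r1 < (1 - δ) * r2 := by
    refine ⟨(r2 - r1) / 4, by linarith, by linarith [hr1.1], ?_⟩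
    nlinarith [hr1.1]
  obtain ⟨Q, hQ⟩ := exists_polynomial_approx_slit (N := N) ht hr2 (half_pos hδ0)
  have hexp : Differentiable ℂ fun w : ℂ => Complex.exp (-Q.eval (w ^ N)) :=
    ((Q.differentiable.comp (differentiable_id.pow N)).neg).cexp
  obtain ⟨e₁, he₁0, he₁⟩ := exists_entire_primitive hexp
  have hroot : ∀ ω w, ω ^ N = 1 → e₁ (ω * w) = ω * e₁ w := by
    intro ω w hω
    have hd : ∀ w, HasDerivAt (fun w => e₁ (ω * w) - ω * e₁ w) 0 w := by
      intro w
      have h1 := (he₁ (ω * w)).comp w ((hasDerivAt_id w).const_mul ω)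
      refine (h1.sub ((he₁ w).const_mul ω)).congr_deriv ?_
      rw [mul_pow, hω, one_mul]
      ring
    have := is_const_of_deriv_eq_zero (fun w => (hd w).differentiableAt)
      (fun w => (hd w).deriv) w 0
    simp only [mul_zero, he₁0, sub_zero] at this
    exact sub_eq_zero.1 this
  let g : ℂ → ℂ := fun z => e₁ (slitMap t N z)
  have hg : ∀ z ∈ ball (0 : ℂ) r2, HasDerivAt g (Complex.exp (-Q.eval (slitMap t N z ^ N)) *
      Complex.exp (slitExponent t N (z ^ N) +
      Complex.log (cayley (z ^ N)) - Complex.log (slitRoot t (z ^ N)))) z := fun z hz =>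
    (he₁ _).comp z (hasDerivAt_slitMap ht hN ((mem_ball_zero_iff.1 hz).trans hr2))
  have hgd : DifferentiableOn ℂ g (ball 0 r2) := fun z hz =>
    (hg z hz).differentiableAt.differentiableWithinAt
  have hgn : ∀ z ∈ ball (0 : ℂ) r2, ‖deriv g z - 1‖ ≤ δ := by
    intro z hz
    have hz2 := mem_ball_zero_iff.1 hz
    have hz1 := hz2.trans hr2
    have hzN : z ^ N ∈ closedBall (0 : ℂ) r2 := by
      rw [mem_closedBall_zero_iff, norm_pow]
      exact (pow_le_of_le_one (norm_nonneg _) hz1.le hN).trans hz2.le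
    rw [(hg z hz).deriv, ← Complex.exp_add, slitMap_pow ht hN hz1]
    have h1 := hQ _ hzN
    rw [norm_sub_rev] at h1
    rw [neg_add_eq_sub]
    refine (norm_exp_sub_one_le (by linarith)).trans (by linarith)
  have hg0 : g 0 = 0 := by simp only [g, slitMap_zero, he₁0]
  have hginj := injOn_of_deriv_near_one hgd hδ1 hgn
  obtain ⟨k, hkd, hk⟩ := exists_inverse_of_deriv_near_one hgd hδ1 hδ0.le hgn hg0
  have hr20 : 0 < r2 := hr1.1.trans hr12
  set σ := (1 + δ) * r1 with hσ
  have hσ0 : 0 < σ := mul_pos (by linarith) hr1.1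
  have hσC : (σ : ℂ) ≠ 0 := by exact_mod_cast hσ0.ne'
  have hscale : ∀ ζ ∈ ball (0 : ℂ) ((1 - δ) * r2 / σ), (σ : ℂ) * ζ ∈ ball 0 ((1 - δ) * r2) := by
    intro ζ hζ
    rw [mem_ball_zero_iff] at hζ ⊢
    rw [norm_mul, norm_real, Real.norm_of_nonneg hσ0.le, mul_comm]
    exact (lt_div_iff₀ hσ0).1 hζ
  have hτ : 1 < (1 - δ) * r2 / σ := (one_lt_div hσ0).2 hδ
  have hkmem : ∀ ζ ∈ ball (0 : ℂ) ((1 - δ) * r2 / σ), ‖k (σ * ζ)‖ < 1 := fun ζ hζ =>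
    (mem_ball_zero_iff.1 (hk _ (hscale ζ hζ)).1).trans hr2
  refine ⟨fun w => (σ : ℂ)⁻¹ * e₁ w, fun ζ => slitMap t N (k (σ * ζ)), (1 - δ) * r2 / σ,
    fun z => ((he₁ z).const_mul _).differentiableAt, fun z => ?_, by simp [he₁0],
    fun ω w hω => by simp only [hroot ω w hω]; ring, hτ, fun ζ hζ => ?_, ?_, fun ζ hζ => ?_,
    fun ζ hζ => ?_, ?_, ?_⟩
  · rw [((he₁ z).const_mul _).deriv]
    exact mul_ne_zero (inv_ne_zero hσC) (Complex.exp_ne_zero _)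
  · have h1 : DifferentiableAt ℂ k (σ * ζ) :=
      (hkd _ (hscale ζ hζ)).differentiableAt (isOpen_ball.mem_nhds (hscale ζ hζ))
    exact ((hasDerivAt_slitMap ht hN (hkmem ζ hζ)).differentiableAt.comp ζ
      (h1.comp ζ (differentiableAt_id.const_mul _))).differentiableWithinAt
  · have h0 := hk 0 (mem_ball_self (by nlinarith))
    have : k 0 = 0 := hginj h0.1 (mem_ball_self hr20) (h0.2.trans hg0.symm)
    simp only [mul_zero, this, slitMap_zero]
  · exact mem_ball_zero_iff.2 (norm_slitMap_lt_one ht hN (hkmem ζ hζ))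
  · have := (hk _ (hscale ζ hζ)).2
    change (σ : ℂ)⁻¹ * g (k (σ * ζ)) = ζ
    rw [this, inv_mul_cancel_left₀ hσC]
  · refine (measure_mono (sdiff_subset_sdiff_right ?_)).trans_lt hvol
    rintro _ ⟨z, hz, rfl⟩
    rw [mem_closedBall_zero_iff] at hz
    have hz2 : z ∈ ball (0 : ℂ) r2 := mem_ball_zero_iff.2 (hz.trans_lt hr12)
    have hgz : ‖g z‖ ≤ σ := by
      have h1 := norm_sub_sub_le_of_deriv_near_one hgd hgn hz2 (mem_ball_self hr20)
      rw [hg0, sub_zero, sub_zero] at h1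
      have h2 := norm_le_norm_sub_add (g z) z
      nlinarith
    refine ⟨(σ : ℂ)⁻¹ * g z, ?_, ?_⟩
    · rw [mem_closedBall_zero_iff, norm_mul, norm_inv, norm_real, Real.norm_of_nonneg hσ0.le,
        inv_mul_le_one₀ hσ0]
      exact hgz
    · have h1 := hk (g z) (mem_ball_zero_iff.2 (hgz.trans_lt hδ))
      simp only [mul_inv_cancel_left₀ hσC, hginj h1.1 hz2 h1.2]
  · obtain ⟨w, hw⟩ := IsAlgClosed.exists_pow_nat_eq (((t : ℂ) - 1) / (t + 1))
      (Nat.pos_of_ne_zero hN)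
    have hwn : ‖w‖ < min η 1 := by
      refine lt_of_pow_lt_pow_left₀ N (by positivity) ?_
      have h1 : ‖((t : ℂ) - 1) / (t + 1)‖ = (1 - t) / (t + 1) := by
        rw [← ofReal_one, ← ofReal_sub, ← ofReal_add, ← ofReal_div, norm_real, Real.norm_eq_abs,
          abs_div, abs_of_neg (by linarith [ht.2]), abs_of_pos (by linarith [ht.1])]
        ring
      rw [← norm_pow, hw, h1]
      refine lt_of_le_of_lt (div_le_self (by linarith [ht.2]) (by linarith [ht.1])) htη
    refine ⟨w, mem_ball_zero_iff.2 (hwn.trans_le (min_le_right _ _)),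
      hwn.trans_le (min_le_left _ _), ?_⟩
    rintro ⟨ζ, hζ, hζw⟩
    exact slitMap_pow_ne ht hN (hkmem ζ (closedBall_subset_ball hτ hζ))
      ((congrArg (· ^ N) hζw).trans hw)

end Perturbation

section Induction

theorem exists_volume_image_le {H : ℂ → ℂ} {τ : ℝ} (hτ : 1 < τ)
    (hH : DifferentiableOn ℂ H (ball 0 τ)) :
    ∃ C : NNReal, ∀ s ⊆ closedBall (0 : ℂ) 1, MeasurableSet s →
      volume (H '' s) ≤ C * volume s := by
  have hsub : closedBall (0 : ℂ) 1 ⊆ ball 0 τ := closedBall_subset_ball hτ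
  have hc : ContDiffOn ℝ 1 H (ball 0 τ) := (hH.contDiffOn isOpen_ball).restrict_scalars ℝ
  have hc1 : ContinuousOn (fun x => (fderiv ℝ H x).det) (closedBall 0 1) :=
    ContinuousLinearMap.continuous_det.comp_continuousOn
      ((hc.continuousOn_fderiv_of_isOpen isOpen_ball le_rfl).mono hsub)
  obtain ⟨C, hC⟩ := (isCompact_closedBall (0 : ℂ) 1).exists_bound_of_continuousOn hc1
  refine ⟨C.toNNReal, fun s hs hms => ?_⟩
  have hd : ∀ x ∈ s, HasFDerivWithinAt H (fderiv ℝ H x) s x := fun x hx =>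
    ((hc.differentiableOn one_ne_zero).differentiableAt
      (isOpen_ball.mem_nhds (hsub (hs hx)))).hasFDerivAt.hasFDerivWithinAt
  refine (addHaar_image_le_lintegral_abs_det_fderiv volume hms hd).trans ?_
  calc ∫⁻ x in s, ENNReal.ofReal |(fderiv ℝ H x).det| ≤ ∫⁻ _ in s, (C.toNNReal : ENNReal) :=
        setLIntegral_mono measurable_const fun x hx => ENNReal.ofReal_le_ofReal (hC x (hs hx))
    _ = C.toNNReal * volume s := setLIntegral_const s _

theorem exists_root_of_unity_lift {E : ℂ → ℂ} (hE : Differentiable ℂ E)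
    (hE' : ∀ z, deriv E z ≠ 0) (hE0 : E 0 = 0) (R : ℝ) {δ : ℝ} (hδ : 0 < δ) {M : ℕ} (hM : M ≠ 0) :
    ∃ q : ℕ, q ≠ 0 ∧ M ∣ q ∧ 3 * M ≤ q ∧ ∃ φ : ℂ → ℂ, DifferentiableOn ℂ φ (ball 0 R) ∧ φ 0 = 0 ∧
      ∀ z ∈ ball 0 R, ‖φ z - z‖ < δ ∧ E (φ z) = Complex.exp (2 * Real.pi * I / q) * E z := by
  obtain ⟨η, hη, h⟩ := exists_lift_rotation hE hE' hE0 R hδ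
  have hlim : Tendsto (fun n : ℕ => Complex.exp (2 * Real.pi * I / n)) atTop (nhds 1) := by
    have h1 := tendsto_const_div_atTop_nhds_zero_nat (2 * Real.pi * I)
    simpa [Function.comp_def] using (Complex.continuous_exp.tendsto 0).comp h1
  have hmul : Tendsto (fun n : ℕ => M * n) atTop atTop :=
    tendsto_id.const_mul_atTop' (Nat.pos_of_ne_zero hM)
  obtain ⟨n, hn, hn3⟩ := (((hlim.comp hmul).eventually (ball_mem_nhds 1 hη)).and
    (eventually_ge_atTop 3)).exists
  refine ⟨M * n, by positivity, dvd_mul_right _ _, ?_, h _ (mem_ball_iff_norm.1 hn)⟩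
  rw [mul_comm]
  exact Nat.mul_le_mul_left M hn3

/-- A stage of the construction: the closed topological disk `H '' closedBall 0 1` together with a
map `φ` near the identity which is conjugate on it to the rotation of order `q`. -/
structure RotationStage (r : ℝ) where
  /-- the entire linearizing map -/
  E : ℂ → ℂ
  /-- the inverse branch of `E` fixing the origin -/
  H : ℂ → ℂ
  /-- the map linearized by `E` -/
  φ : ℂ → ℂ
  /-- the order of the rotation -/
  q : ℕ
  /-- the radius of the domain of the inverse branch -/
  τ : ℝ
  differentiable_E : Differentiable ℂ E
  deriv_E_ne : ∀ z, deriv E z ≠ 0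
  E_zero : E 0 = 0
  one_lt_τ : 1 < τ
  differentiableOn_H : DifferentiableOn ℂ H (ball 0 τ)
  H_zero : H 0 = 0
  mapsTo_H : MapsTo H (ball 0 τ) (ball 0 (2 * r))
  E_H : ∀ ζ ∈ ball 0 τ, E (H ζ) = ζ
  q_ne_zero : q ≠ 0
  differentiableOn_φ : DifferentiableOn ℂ φ (ball 0 (3 * r))
  φ_zero : φ 0 = 0
  E_φ : ∀ z ∈ ball 0 (3 * r), E (φ z) = Complex.exp (2 * Real.pi * I / q) * E z

namespace RotationStage

variable {r : ℝ}

/-- The closed topological disk attached to a stage. -/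
def disk (S : RotationStage r) : Set ℂ := S.H '' closedBall 0 1

theorem exists_initial (hr : 0 < r) {δ : ℝ} (hδ : 0 < δ) :
    ∃ S : RotationStage r, S.disk = closedBall 0 r ∧
      ∀ z ∈ ball (0 : ℂ) (3 * r), ‖S.φ z - z‖ < δ := by
  have hr' : (r : ℂ) ≠ 0 := by exact_mod_cast hr.ne'
  have hE : Differentiable ℂ fun z : ℂ => z / r := differentiable_id.div_const _
  have hE' : ∀ z : ℂ, deriv (fun z : ℂ => z / r) z ≠ 0 := fun z => by
    rw [((hasDerivAt_id' z).div_const (r : ℂ)).deriv]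
    exact one_div_ne_zero hr'
  obtain ⟨q, hq, -, -, φ, hφ, hφ0, h⟩ := exists_root_of_unity_lift hE hE' (zero_div _) (3 * r) hδ
    one_ne_zero
  refine ⟨{ E := fun z => z / r, H := fun z => r * z, φ := φ, q := q, τ := 2,
            differentiable_E := hE, deriv_E_ne := hE', E_zero := zero_div _,
            one_lt_τ := one_lt_two,
            differentiableOn_H := (differentiable_id.const_mul _).differentiableOn,
            H_zero := mul_zero _, mapsTo_H := fun z hz => ?_,
            E_H := fun z _ => mul_div_cancel_left₀ z hr', q_ne_zero := hq,
            differentiableOn_φ := hφ, φ_zero := hφ0, E_φ := fun z hz => (h z hz).2 }, ?_,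
    fun z hz => (h z hz).1⟩
  · rw [mem_ball_zero_iff] at hz ⊢
    rw [norm_mul, norm_real, Real.norm_of_nonneg hr.le, mul_comm]
    exact mul_lt_mul_of_pos_right hz hr
  · change (fun z : ℂ => (r : ℂ) * z) '' closedBall 0 1 = _
    have := smul_closedBall (r : ℂ) (0 : ℂ) zero_le_one
    rw [smul_zero, norm_real, Real.norm_of_nonneg hr.le, mul_one] at this
    exact this

theorem exists_next (S : RotationStage r) {δ η : ℝ} (hδ : 0 < δ) (hη : 0 < η)
    {ε : ENNReal} (hε : 0 < ε) :
    ∃ S' : RotationStage r, S.q ∣ S'.q ∧ 3 * S.q ≤ S'.q ∧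
      (∀ z ∈ ball (0 : ℂ) (3 * r), ‖S'.φ z - z‖ < δ) ∧
      (∀ ω, ω ^ S.q = 1 → ∀ z w, S.E w = ω * S.E z → S'.E w = ω * S'.E z) ∧
      S'.disk ⊆ S.disk ∧ volume (S.disk \ S'.disk) < ε ∧ ∃ p, ‖p‖ < η ∧ p ∉ S'.disk := by
  obtain ⟨C, hC⟩ := exists_volume_image_le S.one_lt_τ S.differentiableOn_H
  have hcont : ContinuousAt S.H 0 := (S.differentiableOn_H.differentiableAt
    (isOpen_ball.mem_nhds (mem_ball_self (zero_lt_one.trans S.one_lt_τ)))).continuousAt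
  have hev : ∀ᶠ w in nhds (0 : ℂ), ‖S.H w‖ < η := by
    refine hcont.norm.eventually (gt_mem_nhds ?_)
    simpa only [S.H_zero, norm_zero] using hη
  obtain ⟨η', hη', hη'H⟩ := Metric.eventually_nhds_iff_ball.1 hev
  obtain ⟨e, h, τ, he, he', he0, hroot, hτ, hh, hh0, hmaps, heh, hvol, w, hw, hwη, hwn⟩ :=
    exists_entire_map_with_inverse_branch S.q_ne_zero hη'
      (ENNReal.div_pos hε.ne' (ENNReal.coe_ne_top (r := C)))
  have hE : Differentiable ℂ (e ∘ S.E) := he.comp S.differentiable_E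
  have hE' : ∀ z, deriv (e ∘ S.E) z ≠ 0 := fun z => by
    rw [deriv_comp z (he _) (S.differentiable_E z)]
    exact mul_ne_zero (he' _) (S.deriv_E_ne z)
  have hE0 : (e ∘ S.E) 0 = 0 := by rw [Function.comp_apply, S.E_zero, he0]
  obtain ⟨q, hq, hdvd, h3, φ, hφ, hφ0, hφE⟩ := exists_root_of_unity_lift hE hE' hE0 (3 * r) hδ
    S.q_ne_zero
  have hball : ball (0 : ℂ) 1 ⊆ ball 0 S.τ := ball_subset_ball S.one_lt_τ.le
  have hcb : closedBall (0 : ℂ) 1 ⊆ ball 0 S.τ := closedBall_subset_ball S.one_lt_τ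
  have hinj : InjOn S.H (ball 0 S.τ) := fun a ha b hb hab => by
    rw [← S.E_H a ha, ← S.E_H b hb, hab]
  have hmaps1 : h '' closedBall 0 1 ⊆ ball 0 1 :=
    (image_mono (closedBall_subset_ball hτ)).trans hmaps.image_subset
  have hdisk : (S.H ∘ h) '' closedBall 0 1 = S.H '' (h '' closedBall 0 1) := image_comp _ _ _
  refine ⟨{ E := e ∘ S.E, H := S.H ∘ h, φ := φ, q := q, τ := τ,
            differentiable_E := hE, deriv_E_ne := hE', E_zero := hE0,
            one_lt_τ := hτ,
            differentiableOn_H := S.differentiableOn_H.comp hh (hmaps.mono_right hball),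
            H_zero := by rw [Function.comp_apply, hh0, S.H_zero],
            mapsTo_H := S.mapsTo_H.comp (hmaps.mono_right hball),
            E_H := fun z hz => ?_, q_ne_zero := hq,
            differentiableOn_φ := hφ, φ_zero := hφ0, E_φ := fun z hz => (hφE z hz).2 },
    hdvd, h3, fun z hz => (hφE z hz).1, fun ω hω z w hzw => ?_, ?_, ?_, S.H w, ?_, ?_⟩
  · simp only [Function.comp_apply]
    rw [S.E_H _ (hball (hmaps hz)), heh z hz]
  · simp only [Function.comp_apply, hzw, hroot ω _ hω]
  · change (S.H ∘ h) '' closedBall 0 1 ⊆ S.H '' closedBall 0 1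
    rw [hdisk]
    exact image_mono (hmaps1.trans ball_subset_closedBall)
  · change volume (S.H '' closedBall 0 1 \ (S.H ∘ h) '' closedBall 0 1) < ε
    have hclosed : IsClosed (h '' closedBall 0 1) :=
      ((isCompact_closedBall (0 : ℂ) 1).image_of_continuousOn
        (hh.continuousOn.mono (closedBall_subset_ball hτ))).isClosed
    rw [hdisk, ← (hinj.mono hcb).image_sdiff_subset (hmaps1.trans ball_subset_closedBall)]
    have hms : MeasurableSet (closedBall (0 : ℂ) 1 \ h '' closedBall 0 1) :=
      measurableSet_closedBall.diff hclosed.measurableSet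
    refine (hC _ sdiff_subset hms).trans_lt ?_
    have hle : volume (closedBall (0 : ℂ) 1 \ h '' closedBall 0 1) ≤
        volume (ball (0 : ℂ) 1 \ h '' closedBall 0 1) := by
      rw [← ball_union_sphere, union_sdiff_distrib]
      refine (measure_union_le _ _).trans ?_
      rw [measure_mono_null sdiff_subset (Measure.addHaar_sphere volume (0 : ℂ) 1), add_zero]
    exact ENNReal.mul_lt_of_lt_div' (hle.trans_lt hvol)
  · exact hη'H w (mem_ball_zero_iff.2 hwη)
  · change S.H w ∉ (S.H ∘ h) '' closedBall 0 1
    rw [hdisk]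
    intro hmem
    exact hwn ((hinj.mem_image_iff (hmaps1.trans hball) (hball hw)).1 hmem)

end RotationStage

end Induction

section Tower

/-- A nested sequence of stages with rotations tending quickly to the identity and whose disks keep
a definite area but do not contain any neighborhood of the origin in the limit. -/
structure RotationTower (r : ℝ) where
  /-- the stages -/
  stage : ℕ → RotationStage r
  disk_zero : (stage 0).disk = closedBall 0 r
  norm_φ_sub_lt : ∀ n, ∀ z ∈ ball (0 : ℂ) (3 * r), ‖(stage n).φ z - z‖ < r / 4 / 2 / 2 ^ n
  q_dvd : ∀ n, (stage n).q ∣ (stage (n + 1)).q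
  three_mul_q_le : ∀ n, 3 * (stage n).q ≤ (stage (n + 1)).q
  E_succ : ∀ n ω, ω ^ (stage n).q = 1 → ∀ z w, (stage n).E w = ω * (stage n).E z →
    (stage (n + 1)).E w = ω * (stage (n + 1)).E z
  disk_succ_subset : ∀ n, (stage (n + 1)).disk ⊆ (stage n).disk
  tsum_volume_lt : ∑' n, volume ((stage n).disk \ (stage (n + 1)).disk) <
    volume (closedBall (0 : ℂ) r)
  exists_notMem_disk : ∀ n : ℕ, ∃ p : ℂ, ‖p‖ < 1 / (n + 1) ∧ p ∉ (stage (n + 1)).disk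

theorem exists_rotationTower {r : ℝ} (hr : 0 < r) : Nonempty (RotationTower r) := by
  obtain ⟨S₀, hdisk, hφ⟩ := RotationStage.exists_initial hr
    (show 0 < r / 4 / 2 / 2 ^ 0 by positivity)
  obtain ⟨ε, hε, hsum⟩ := ENNReal.exists_pos_sum_of_countable
    (measure_closedBall_pos volume (0 : ℂ) hr).ne' ℕ
  choose next h1 h2 h3 h4 h5 h6 h7 using fun (n : ℕ) (S : RotationStage r) =>
    S.exists_next (show 0 < r / 4 / 2 / 2 ^ (n + 1) by positivity)
      (show (0 : ℝ) < 1 / (n + 1) by positivity) (ENNReal.coe_pos.2 (hε n))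
  let S : ℕ → RotationStage r := fun n => Nat.rec S₀ next n
  refine ⟨⟨S, hdisk, fun n => ?_, fun n => h1 n (S n), fun n => h2 n (S n),
    fun n => h4 n (S n), fun n => h5 n (S n), ?_, fun n => h7 n (S n)⟩⟩
  · cases n with
    | zero => exact hφ
    | succ n => exact h3 n (S n)
  · exact (ENNReal.tsum_le_tsum fun n => (h6 n (S n)).le).trans_lt hsum

namespace RotationTower

variable {r : ℝ} (T : RotationTower r) (a b : ℕ → Bool)

/-- The composition of the first `n` maps selected by `a`. -/
def partialMap : ℕ → ℂ → ℂ
  | 0 => id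
  | n + 1 => fun z => bif a n then (T.stage n).φ (partialMap n z) else partialMap n z

/-- The partial sums of the rotation number associated with `a`. -/
def partialAngle (n : ℕ) : ℝ := ∑ k ∈ Finset.range n, bif a k then 1 / ((T.stage k).q : ℝ) else 0

theorem partialMap_succ (n : ℕ) (z : ℂ) : T.partialMap a (n + 1) z =
    bif a n then (T.stage n).φ (T.partialMap a n z) else T.partialMap a n z := rfl

variable {T a b}

theorem r_pos (T : RotationTower r) : 0 < r := by
  by_contra hr
  push Not at hr
  have h := (T.stage 0).mapsTo_H (mem_ball_self (zero_lt_one.trans (T.stage 0).one_lt_τ))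
  rw [mem_ball_zero_iff] at h
  linarith [norm_nonneg ((T.stage 0).H 0)]

theorem norm_partialMap_sub_le {z : ℂ} (hz : z ∈ ball (0 : ℂ) (2 * r)) (n : ℕ) :
    ‖T.partialMap a n z - z‖ ≤ r / 4 * (1 - 1 / 2 ^ n) ∧
      T.partialMap a n z ∈ ball (0 : ℂ) (3 * r) := by
  have hr : 0 < r := T.r_pos
  have hmem : ∀ n, ‖T.partialMap a n z - z‖ ≤ r / 4 * (1 - 1 / 2 ^ n) →
      T.partialMap a n z ∈ ball (0 : ℂ) (3 * r) := by
    intro n h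
    rw [mem_ball_zero_iff] at hz ⊢
    have h1 := norm_le_norm_sub_add (T.partialMap a n z) z
    have h2 : (0 : ℝ) < 1 / 2 ^ n := by positivity
    nlinarith
  suffices h : ‖T.partialMap a n z - z‖ ≤ r / 4 * (1 - 1 / 2 ^ n) from ⟨h, hmem n h⟩
  induction n with
  | zero => simp [partialMap]
  | succ n ih =>
    rw [partialMap_succ]
    have h2 : (0 : ℝ) < 1 / 2 ^ n := by positivity
    have h3 : (1 : ℝ) / 2 ^ (n + 1) = 1 / 2 ^ n / 2 := by rw [pow_succ]; field_simp
    rw [h3]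
    cases a n with
    | false =>
      simp only [cond_false]
      nlinarith
    | true =>
      simp only [cond_true]
      have h1 := norm_sub_le_norm_sub_add_norm_sub ((T.stage n).φ (T.partialMap a n z))
        (T.partialMap a n z) z
      have h4 := T.norm_φ_sub_lt n _ (hmem n ih)
      have h5 : r / 4 / 2 / 2 ^ n = r / 4 / 2 * (1 / 2 ^ n) := by ring
      rw [h5] at h4
      nlinarith

theorem partialMap_mem_ball {z : ℂ} (hz : z ∈ ball (0 : ℂ) r) (n : ℕ) :
    T.partialMap a n z ∈ ball (0 : ℂ) (2 * r) := by
  have hr : 0 < r := T.r_pos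
  have h := (norm_partialMap_sub_le (T := T) (a := a)
    (ball_subset_ball (by linarith : r ≤ 2 * r) hz) n).1
  rw [mem_ball_zero_iff] at hz ⊢
  have h1 := norm_le_norm_sub_add (T.partialMap a n z) z
  have h2 : (0 : ℝ) < 1 / 2 ^ n := by positivity
  nlinarith

theorem dist_partialMap_succ_le {z : ℂ} (hz : z ∈ ball (0 : ℂ) (2 * r)) (n : ℕ) :
    dist (T.partialMap a n z) (T.partialMap a (n + 1) z) ≤ r / 4 / 2 / 2 ^ n := by
  have hr : 0 < r := T.r_pos
  rw [partialMap_succ, dist_comm, dist_eq_norm]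
  cases a n with
  | false =>
    simp only [cond_false, sub_self, norm_zero]
    positivity
  | true =>
    exact (T.norm_φ_sub_lt n _ (norm_partialMap_sub_le hz n).2).le

theorem partialMap_zero_right (n : ℕ) : T.partialMap a n 0 = 0 := by
  induction n with
  | zero => rfl
  | succ n ih =>
    rw [partialMap_succ, ih, (T.stage n).φ_zero]
    cases a n <;> rfl

theorem differentiableOn_partialMap (n : ℕ) :
    DifferentiableOn ℂ (T.partialMap a n) (ball 0 (2 * r)) := by
  induction n with
  | zero => exact differentiableOn_id
  | succ n ih =>
    have h : T.partialMap a (n + 1) =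
        fun z => bif a n then (T.stage n).φ (T.partialMap a n z) else T.partialMap a n z := rfl
    rw [h]
    cases a n with
    | false => exact ih
    | true => exact (T.stage n).differentiableOn_φ.comp ih fun z hz =>
        (norm_partialMap_sub_le hz n).2

theorem q_dvd_of_le {k m : ℕ} (h : k ≤ m) : (T.stage k).q ∣ (T.stage m).q := by
  induction h with
  | refl => exact dvd_rfl
  | step _ ih => exact ih.trans (T.q_dvd _)

theorem E_φ_of_le {k m : ℕ} (h : k ≤ m) {z : ℂ} (hz : z ∈ ball (0 : ℂ) (3 * r)) :
    (T.stage m).E ((T.stage k).φ z) =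
      Complex.exp (2 * Real.pi * I / (T.stage k).q) * (T.stage m).E z := by
  induction m, h using Nat.le_induction with
  | base => exact (T.stage k).E_φ z hz
  | succ m hm ih =>
    refine T.E_succ m _ ?_ _ _ ih
    obtain ⟨c, hc⟩ := q_dvd_of_le (T := T) hm
    have hq : ((T.stage k).q : ℂ) ≠ 0 := by exact_mod_cast (T.stage k).q_ne_zero
    rw [hc, pow_mul, ← Complex.exp_nat_mul, mul_div_cancel₀ _ hq, exp_two_pi_mul_I, one_pow]

theorem E_partialMap {n m : ℕ} (h : n ≤ m + 1) {z : ℂ} (hz : z ∈ ball (0 : ℂ) (2 * r)) :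
    (T.stage m).E (T.partialMap a n z) =
      Complex.exp (2 * Real.pi * I * T.partialAngle a n) * (T.stage m).E z := by
  induction n with
  | zero => simp [partialMap, partialAngle]
  | succ n ih =>
    rw [partialMap_succ, partialAngle, Finset.sum_range_succ, ← partialAngle]
    cases a n with
    | false => simpa using ih (by lia)
    | true =>
      simp only [cond_true]
      rw [E_φ_of_le (by lia) (norm_partialMap_sub_le hz n).2, ih (by lia), ← mul_assoc,
        ← Complex.exp_add]
      congr 2
      push_cast
      ring

theorem norm_exp_two_pi_mul_I_mul (x : ℝ) : ‖Complex.exp (2 * Real.pi * I * x)‖ = 1 := by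
  rw [show (2 * Real.pi * I * x : ℂ) = ((2 * Real.pi * x : ℝ) : ℂ) * I by push_cast; ring,
    norm_exp_ofReal_mul_I]

theorem partialMap_H {n m : ℕ} (h : n ≤ m + 1) {ζ : ℂ} (hζ : ζ ∈ ball (0 : ℂ) (T.stage m).τ) :
    T.partialMap a n ((T.stage m).H ζ) =
      (T.stage m).H (Complex.exp (2 * Real.pi * I * T.partialAngle a n) * ζ) := by
  set S := T.stage m
  set c := Complex.exp (2 * Real.pi * I * T.partialAngle a n) with hc
  have hrot : MapsTo (fun ζ => c * ζ) (ball (0 : ℂ) S.τ) (ball 0 S.τ) := fun w hw => by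
    rw [mem_ball_zero_iff] at hw ⊢
    rwa [norm_mul, hc, norm_exp_two_pi_mul_I_mul, one_mul]
  refine eqOn_ball_of_comp_eq (E := S.E) (u := fun ζ => T.partialMap a n (S.H ζ))
    (v := fun ζ => S.H (c * ζ)) (zero_lt_one.trans S.one_lt_τ) S.differentiable_E (S.deriv_E_ne 0)
    ((differentiableOn_partialMap n).comp S.differentiableOn_H S.mapsTo_H)
    (S.differentiableOn_H.comp (differentiable_id.const_mul c).differentiableOn hrot)
    ?_ ?_ (fun w hw => ?_) hζ
  · simp only [S.H_zero, partialMap_zero_right]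
  · simp only [mul_zero, S.H_zero]
  · rw [E_partialMap h (S.mapsTo_H hw), S.E_H w hw, S.E_H _ (hrot hw)]

theorem partialMap_image_disk {n m : ℕ} (h : n ≤ m + 1) :
    T.partialMap a n '' (T.stage m).disk = (T.stage m).disk := by
  have hsub : closedBall (0 : ℂ) 1 ⊆ ball 0 (T.stage m).τ :=
    closedBall_subset_ball (T.stage m).one_lt_τ
  apply Subset.antisymm
  · rintro _ ⟨_, ⟨ζ, hζ, rfl⟩, rfl⟩
    refine ⟨_, ?_, (partialMap_H h (hsub hζ)).symm⟩
    rw [mem_closedBall_zero_iff] at hζ ⊢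
    rwa [norm_mul, norm_exp_two_pi_mul_I_mul, one_mul]
  · rintro _ ⟨ζ, hζ, rfl⟩
    set c := Complex.exp (2 * Real.pi * I * T.partialAngle a n) with hc
    have hζ' : c⁻¹ * ζ ∈ closedBall (0 : ℂ) 1 := by
      rw [mem_closedBall_zero_iff] at hζ ⊢
      rwa [norm_mul, norm_inv, hc, norm_exp_two_pi_mul_I_mul, inv_one, one_mul]
    refine ⟨_, mem_image_of_mem _ hζ', ?_⟩
    rw [partialMap_H h (hsub hζ'), ← hc, mul_inv_cancel_left₀ (Complex.exp_ne_zero _)]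

theorem partialMap_comm {z : ℂ} (hz : z ∈ ball (0 : ℂ) r) (n : ℕ) :
    T.partialMap a n (T.partialMap b n z) = T.partialMap b n (T.partialMap a n z) := by
  have hr : 0 < r := T.r_pos
  have hsub : ball (0 : ℂ) r ⊆ ball 0 (2 * r) := ball_subset_ball (by linarith)
  have hd : ∀ a b : ℕ → Bool,
      DifferentiableOn ℂ (fun z => T.partialMap a n (T.partialMap b n z)) (ball 0 r) := fun a b =>
    (differentiableOn_partialMap n).comp ((differentiableOn_partialMap n).mono hsub)
      fun w hw => partialMap_mem_ball hw n
  refine eqOn_ball_of_comp_eq hr (T.stage n).differentiable_E ((T.stage n).deriv_E_ne 0)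
    (hd a b) (hd b a) ?_ ?_ (fun w hw => ?_) hz
  · simp only [partialMap_zero_right]
  · simp only [partialMap_zero_right]
  · rw [E_partialMap n.le_succ (partialMap_mem_ball hw n), E_partialMap n.le_succ (hsub hw),
      E_partialMap n.le_succ (partialMap_mem_ball hw n), E_partialMap n.le_succ (hsub hw)]
    ring

theorem deriv_partialMap_zero (n : ℕ) :
    deriv (T.partialMap a n) 0 = Complex.exp (2 * Real.pi * I * T.partialAngle a n) := by
  have hr : 0 < r := T.r_pos
  have hnhds : ball (0 : ℂ) (2 * r) ∈ nhds 0 := ball_mem_nhds _ (by linarith)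
  set S := T.stage n
  have h1 : HasDerivAt (fun z => S.E (T.partialMap a n z))
      (deriv S.E 0 * deriv (T.partialMap a n) 0) 0 := by
    have h0 := (S.differentiable_E 0).hasDerivAt
    rw [← partialMap_zero_right (T := T) (a := a) n] at h0
    have := h0.comp 0 ((differentiableOn_partialMap (T := T) (a := a) n).differentiableAt
      hnhds).hasDerivAt
    rwa [partialMap_zero_right] at this
  have h2 := ((S.differentiable_E 0).hasDerivAt.const_mul
    (Complex.exp (2 * Real.pi * I * T.partialAngle a n))).congr_of_eventuallyEq
    (Filter.eventually_of_mem hnhds fun z hz => E_partialMap n.le_succ hz)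
  have h3 := h1.unique h2
  rw [mul_comm] at h3
  exact mul_right_cancel₀ (S.deriv_E_ne 0) h3

end RotationTower

end Tower

section Limit

namespace RotationTower

variable {r : ℝ} (T : RotationTower r) (a b : ℕ → Bool)

/-- The infinite composition of the maps selected by `a`. -/
def limitMap (z : ℂ) : ℂ := limUnder atTop fun n => T.partialMap a n z

/-- The rotation number associated with `a`. -/
def angle : ℝ := ∑' k, bif a k then 1 / ((T.stage k).q : ℝ) else 0

/-- The intersection of all the disks. -/
def hedgehog : Set ℂ := ⋂ n, (T.stage n).disk

variable {T a b}

theorem tendsto_partialMap {z : ℂ} (hz : z ∈ ball (0 : ℂ) (2 * r)) :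
    Tendsto (fun n => T.partialMap a n z) atTop (nhds (T.limitMap a z)) :=
  (cauchySeq_of_le_geometric_two (C := r / 4) fun n => dist_partialMap_succ_le hz n).tendsto_limUnder

theorem tendstoUniformlyOn_partialMap :
    TendstoUniformlyOn (T.partialMap a) (T.limitMap a) atTop (ball 0 (2 * r)) := by
  rw [Metric.tendstoUniformlyOn_iff]
  intro ε hε
  have hlim : Tendsto (fun n : ℕ => r / 4 / 2 ^ n) atTop (nhds 0) := by
    have := (tendsto_pow_atTop_nhds_zero_of_lt_one (r := (1 / 2 : ℝ)) (by norm_num)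
      (by norm_num)).const_mul (r / 4)
    rw [mul_zero] at this
    refine this.congr fun n => ?_
    rw [one_div, inv_pow]
    rfl
  filter_upwards [hlim.eventually (gt_mem_nhds hε)] with n hn z hz
  rw [dist_comm]
  exact (dist_le_of_le_geometric_two_of_tendsto (fun n => dist_partialMap_succ_le hz n)
    (tendsto_partialMap hz) n).trans_lt hn

theorem differentiableOn_limitMap : DifferentiableOn ℂ (T.limitMap a) (ball 0 (2 * r)) :=
  tendstoUniformlyOn_partialMap.tendstoLocallyUniformlyOn.differentiableOn
    (Eventually.of_forall differentiableOn_partialMap) isOpen_ball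

theorem norm_limitMap_sub_le {z : ℂ} (hz : z ∈ ball (0 : ℂ) (2 * r)) :
    ‖T.limitMap a z - z‖ ≤ r / 4 := by
  have h := dist_le_of_le_geometric_two_of_tendsto (fun n => dist_partialMap_succ_le (T := T) (a := a) hz n)
    (tendsto_partialMap hz) 0
  rw [pow_zero, div_one, dist_comm, dist_eq_norm] at h
  exact h

theorem limitMap_zero : T.limitMap a 0 = 0 := by
  have hr := T.r_pos
  have h := tendsto_partialMap (T := T) (a := a) (mem_ball_self (by linarith : 0 < 2 * r))
  simp only [partialMap_zero_right] at h
  exact tendsto_nhds_unique h tendsto_const_nhds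

theorem tendsto_partialMap_of_tendsto {z : ℂ} (hz : z ∈ ball (0 : ℂ) (2 * r)) {φ : ℕ → ℕ}
    (hφ : Tendsto φ atTop atTop) {w : ℕ → ℂ} (hw : Tendsto w atTop (nhds z)) :
    Tendsto (fun n => T.partialMap a (φ n) (w n)) atTop (nhds (T.limitMap a z)) := by
  have hU : TendstoLocallyUniformlyOn (fun n => T.partialMap a (φ n)) (T.limitMap a) atTop
      (ball 0 (2 * r)) := by
    have h := tendstoUniformlyOn_partialMap (T := T) (a := a)
    exact TendstoUniformlyOn.tendstoLocallyUniformlyOn fun u hu => hφ.eventually (h u hu)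
  exact hU.tendsto_comp (differentiableOn_limitMap.continuousOn z hz) hz
    (tendsto_nhdsWithin_iff.2 ⟨hw, hw.eventually (isOpen_ball.mem_nhds hz)⟩)

theorem limitMap_comm {z : ℂ} (hz : z ∈ ball (0 : ℂ) r) :
    T.limitMap a (T.limitMap b z) = T.limitMap b (T.limitMap a z) := by
  have hr := T.r_pos
  have hz2 : z ∈ ball (0 : ℂ) (2 * r) := ball_subset_ball (by linarith) hz
  have hmem : ∀ a : ℕ → Bool, T.limitMap a z ∈ ball (0 : ℂ) (2 * r) := fun a => by
    have h := norm_limitMap_sub_le (T := T) (a := a) hz2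
    rw [mem_ball_zero_iff] at hz ⊢
    have h1 := norm_le_norm_sub_add (T.limitMap a z) z
    linarith
  have h := fun a b : ℕ → Bool => tendsto_partialMap_of_tendsto (T := T) (a := a) (hmem b)
    tendsto_id (tendsto_partialMap hz2)
  refine tendsto_nhds_unique (h a b) ((h b a).congr fun n => ?_)
  exact partialMap_comm hz n

theorem norm_deriv_limitMap_sub_one_le {z : ℂ} (hz : z ∈ ball (0 : ℂ) r) :
    ‖deriv (T.limitMap a) z - 1‖ ≤ 1 / 2 := by
  have hr := T.r_pos
  rw [mem_ball_zero_iff] at hz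
  have hsub : closedBall z (r / 2) ⊆ ball 0 (2 * r) := fun w hw => by
    rw [mem_closedBall_iff_norm] at hw
    rw [mem_ball_zero_iff]
    have h1 := norm_le_norm_sub_add w z
    linarith
  have hdat : ∀ w ∈ ball (0 : ℂ) (2 * r), DifferentiableAt ℂ (T.limitMap a) w := fun w hw =>
    differentiableOn_limitMap.differentiableAt (isOpen_ball.mem_nhds hw)
  have hd : DifferentiableOn ℂ (fun w => T.limitMap a w - w) (ball 0 (2 * r)) :=
    differentiableOn_limitMap.sub differentiableOn_id
  have hzmem : z ∈ ball (0 : ℂ) (2 * r) := hsub (mem_closedBall_self (by linarith))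
  have h := Complex.norm_deriv_le_of_forall_mem_sphere_norm_le (half_pos hr)
    ((hd.mono hsub).diffContOnCl_ball le_rfl)
    fun w hw => norm_limitMap_sub_le (hsub (sphere_subset_closedBall hw))
  have hderiv : HasDerivAt (fun w => T.limitMap a w - w) (deriv (T.limitMap a) z - 1) z :=
    (hdat z hzmem).hasDerivAt.sub (hasDerivAt_id' z)
  rw [hderiv.deriv] at h
  refine h.trans_eq ?_
  field_simp
  norm_num

theorem injOn_limitMap : InjOn (T.limitMap a) (ball 0 r) :=
  injOn_of_deriv_near_one
    (differentiableOn_limitMap.mono (ball_subset_ball (by linarith [T.r_pos]))) one_half_lt_one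
    fun _ hz => norm_deriv_limitMap_sub_one_le hz

theorem pow_three_mul_q_le (n k : ℕ) : 3 ^ k * (T.stage n).q ≤ (T.stage (n + k)).q := by
  induction k with
  | zero => simp
  | succ k ih =>
    have h := T.three_mul_q_le (n + k)
    rw [pow_succ, ← add_assoc]
    lia

theorem one_div_q_le (n k : ℕ) :
    1 / ((T.stage (n + k)).q : ℝ) ≤ 1 / (T.stage n).q * (1 / 3) ^ k := by
  have hq : (0 : ℝ) < (T.stage n).q := by exact_mod_cast Nat.pos_of_ne_zero (T.stage n).q_ne_zero
  have h : (3 : ℝ) ^ k * (T.stage n).q ≤ (T.stage (n + k)).q := by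
    exact_mod_cast pow_three_mul_q_le n k
  rw [one_div_pow, one_div_mul_one_div, mul_comm]
  exact one_div_le_one_div_of_le (by positivity) h

theorem angle_term_le (k : ℕ) :
    ‖(bif a k then 1 / ((T.stage k).q : ℝ) else 0)‖ ≤ (1 / 3 : ℝ) ^ k := by
  cases a k with
  | false => simp only [cond_false, norm_zero]; positivity
  | true =>
    have h := one_div_q_le (T := T) 0 k
    have hq : (1 : ℝ) ≤ (T.stage 0).q := by
      exact_mod_cast Nat.one_le_iff_ne_zero.2 (T.stage 0).q_ne_zero
    have h2 : 1 / ((T.stage 0).q : ℝ) ≤ 1 := (div_le_one (by linarith)).2 hq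
    rw [zero_add] at h
    rw [cond_true, Real.norm_of_nonneg (by positivity)]
    exact h.trans (mul_le_of_le_one_left (by positivity) h2)

theorem summable_angle : Summable fun k => bif a k then 1 / ((T.stage k).q : ℝ) else 0 :=
  Summable.of_norm_bounded (summable_geometric_of_lt_one (by norm_num) (by norm_num))
    angle_term_le

theorem tendsto_partialAngle : Tendsto (T.partialAngle a) atTop (nhds (T.angle a)) :=
  summable_angle.hasSum.tendsto_sum_nat

theorem deriv_limitMap_zero :
    deriv (T.limitMap a) 0 = Complex.exp (2 * Real.pi * I * T.angle a) := by
  have hr := T.r_pos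
  have h1 := (tendstoUniformlyOn_partialMap (T := T) (a := a)).tendstoLocallyUniformlyOn.deriv
    (Eventually.of_forall differentiableOn_partialMap) isOpen_ball
  have h2 := h1.tendsto_at (mem_ball_self (by linarith))
  have h3 : Tendsto (fun n => Complex.exp (2 * Real.pi * I * T.partialAngle a n)) atTop
      (nhds (Complex.exp (2 * Real.pi * I * T.angle a))) :=
    (Complex.continuous_exp.tendsto _).comp (((continuous_ofReal.tendsto _).comp
      tendsto_partialAngle).const_mul _)
  exact tendsto_nhds_unique h2 (h3.congr fun n => (deriv_partialMap_zero n).symm)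

theorem continuous_angle : Continuous T.angle := by
  refine continuous_tsum (fun k => ?_) (summable_geometric_of_lt_one (r := (1 / 3 : ℝ))
    (by norm_num) (by norm_num)) fun k a => angle_term_le k
  exact (continuous_of_discreteTopology
    (f := fun b : Bool => bif b then 1 / ((T.stage k).q : ℝ) else 0)).comp (continuous_apply k)

theorem angle_lt_angle {n : ℕ} (hlt : ∀ k < n, a k = b k) (ha : a n = false) (hb : b n = true) :
    T.angle a < T.angle b := by
  have hq : (0 : ℝ) < (T.stage n).q := by exact_mod_cast Nat.pos_of_ne_zero (T.stage n).q_ne_zero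
  have hnn : ∀ (b : ℕ → Bool) k, 0 ≤ (bif b k then 1 / ((T.stage k).q : ℝ) else 0) :=
    fun b k => by cases b k <;> simp
  have h1 : T.partialAngle b (n + 1) ≤ T.angle b :=
    summable_angle.sum_le_tsum _ fun k _ => hnn b k
  have h2 := (summable_angle (T := T) (a := a)).sum_add_tsum_nat_add (n + 1)
  have h3 : ∑' k, (bif a (k + (n + 1)) then 1 / ((T.stage (k + (n + 1))).q : ℝ) else 0) ≤
      ∑' k : ℕ, 1 / ((T.stage n).q : ℝ) * (1 / 3) * (1 / 3) ^ k := by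
    refine Summable.tsum_le_tsum (fun k => ?_)
      ((summable_nat_add_iff (n + 1)).2 summable_angle)
      ((summable_geometric_of_lt_one (by norm_num) (by norm_num)).mul_left _)
    cases a (k + (n + 1)) with
    | false => simp only [cond_false]; positivity
    | true =>
      have := one_div_q_le (T := T) n (k + 1)
      rw [pow_succ'] at this
      simp only [cond_true]
      rw [show k + (n + 1) = n + (k + 1) by lia]
      linarith
  rw [tsum_mul_left, tsum_geometric_of_lt_one (by norm_num) (by norm_num)] at h3
  have h4 : T.partialAngle a (n + 1) = T.partialAngle b n := by
    rw [partialAngle, Finset.sum_range_succ, ha, cond_false, add_zero]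
    exact Finset.sum_congr rfl fun k hk => by rw [hlt k (Finset.mem_range.1 hk)]
  have h5 : T.partialAngle b (n + 1) = T.partialAngle b n + 1 / (T.stage n).q := by
    rw [partialAngle, Finset.sum_range_succ, hb, cond_true]
    rfl
  have h6 : T.angle a = T.partialAngle a (n + 1) +
      ∑' k, (bif a (k + (n + 1)) then 1 / ((T.stage (k + (n + 1))).q : ℝ) else 0) := h2.symm
  have h7 : (0 : ℝ) < 1 / (T.stage n).q := by positivity
  rw [show (1 - 1 / 3 : ℝ)⁻¹ = 3 / 2 by norm_num] at h3
  linarith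

theorem injective_angle : Function.Injective T.angle := by
  intro a b hab
  by_contra hne
  have hex : ∃ n, a n ≠ b n := Function.ne_iff.1 hne
  classical
  have hn := Nat.find_spec hex
  have hlt : ∀ k < Nat.find hex, a k = b k := fun k hk => not_not.1 (Nat.find_min hex hk)
  rcases ha : a (Nat.find hex) with _ | _ <;> rcases hb : b (Nat.find hex) with _ | _
  · exact hn (ha.trans hb.symm)
  · exact (angle_lt_angle hlt ha hb).ne hab
  · exact (angle_lt_angle (fun k hk => (hlt k hk).symm) hb ha).ne hab.symm
  · exact hn (ha.trans hb.symm)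

theorem isCompact_range_angle : IsCompact (range T.angle) := isCompact_range continuous_angle

theorem not_countable_range_angle : ¬ (range T.angle).Countable := by
  intro h
  have h1 := h.preimage (injective_angle (T := T))
  rw [preimage_range, countable_univ_iff] at h1
  obtain ⟨f, hf⟩ := exists_surjective_nat (ℕ → Bool)
  obtain ⟨k, hk⟩ := hf fun n => !(f n n)
  have := congrFun hk k
  simp at this

end RotationTower

end Limit

section Invariance

theorem denseRange_pow_circle_exp {t : ℝ} (ht : Irrational t) :
    DenseRange fun n : ℕ => Circle.exp (2 * Real.pi * t) ^ n := by
  have hz : DenseRange (· • (t : AddCircle (1 : ℝ)) : ℤ → AddCircle (1 : ℝ)) :=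
    AddCircle.denseRange_zsmul_coe_iff.2 (by rwa [div_one])
  have hn := denseRange_zsmul_iff_nsmul.1 hz
  have himage := (AddCircle.homeomorphCircle one_ne_zero).surjective.denseRange.comp hn
    (AddCircle.homeomorphCircle (T := (1 : ℝ)) one_ne_zero).continuous
  convert himage using 2 with n
  rw [Function.comp_apply, AddCircle.homeomorphCircle_apply, AddCircle.toCircle_nsmul,
    AddCircle.toCircle_apply_mk, div_one]

/-- An invariant continuum through the origin which is not a neighbourhood of it obstructs
linearizability with irrational rotation number. -/
theorem not_linearizable_of_mapsTo {K : Set ℂ} (hclosed : IsClosed K) (hK : IsPreconnected K)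
    (h0 : (0 : ℂ) ∈ K) (hne : K ≠ {0}) (hnhds : K ∉ nhds (0 : ℂ)) {F : ℂ → ℂ} (hF : MapsTo F K K)
    {t : ℝ} (ht : Irrational t) : ¬ Linearizable t F := by
  rintro ⟨h, V, hVo, h0V, hd, hinj, hh0, hconj⟩
  obtain ⟨p, hpK, hp0⟩ : ∃ p ∈ K, p ≠ 0 := by
    by_contra! hcon
    exact hne (Subset.antisymm (fun x hx => hcon x hx) (singleton_subset_iff.2 h0))
  have hcont : ContinuousAt h 0 := hd.continuousOn.continuousAt (hVo.mem_nhds h0V)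
  have hev : ∀ᶠ z in nhds (0 : ℂ), h z ≠ p :=
    hcont.eventually_ne (by rw [hh0]; exact hp0.symm)
  obtain ⟨ε, hε, hball⟩ := Metric.eventually_nhds_iff_ball.1
    (hconj.and (hev.and (hVo.mem_nhds h0V)))
  have hsub : ball (0 : ℂ) ε ⊆ V := fun z hz => (hball z hz).2.2
  have hopen : ∀ U ⊆ ball (0 : ℂ) ε, IsOpen U → IsOpen (h '' U) := by
    rcases ((hd.mono hsub).analyticOnNhd isOpen_ball).is_constant_or_isOpen
      (convex_ball (0 : ℂ) ε).isPreconnected with ⟨w, hw⟩ | hopen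
    · have hmem : ((ε / 2 : ℝ) : ℂ) ∈ ball (0 : ℂ) ε := by
        rw [mem_ball_zero_iff, Complex.norm_real, Real.norm_of_nonneg (by positivity)]
        linarith
      have := hinj (hsub hmem) h0V
        ((hw _ hmem).trans (hw _ (mem_ball_self hε)).symm)
      rw [Complex.ofReal_eq_zero] at this
      linarith
    · exact hopen
  have hmeet : ∀ c, 0 < c → c < ε → ∃ z : ℂ, ‖z‖ = c ∧ h z ∈ K := by
    intro c hc hcε
    by_contra! hcon
    have hcb : closedBall (0 : ℂ) c ⊆ ball 0 ε := closedBall_subset_ball hcε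
    have hcomp : IsCompact (h '' closedBall 0 c) :=
      (isCompact_closedBall 0 c).image_of_continuousOn
        (hd.continuousOn.mono (hcb.trans hsub))
    obtain ⟨x, -, ⟨z, hz, rfl⟩, hx⟩ := hK (h '' ball 0 c) (h '' closedBall 0 c)ᶜ
      (hopen _ (ball_subset_closedBall.trans hcb) isOpen_ball) hcomp.isClosed.isOpen_compl
      (by
        intro x hx
        by_cases hxc : x ∈ h '' closedBall 0 c
        · obtain ⟨z, hz, rfl⟩ := hxc
          refine Or.inl ⟨z, ?_, rfl⟩
          rw [mem_closedBall_zero_iff] at hz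
          exact mem_ball_zero_iff.2 (lt_of_le_of_ne hz fun he => hcon z he hx)
        · exact Or.inr hxc)
      ⟨0, h0, 0, mem_ball_self hc, hh0⟩
      ⟨p, hpK, by
        rintro ⟨z, hz, hzp⟩
        exact (hball z (hcb hz)).2.1 hzp⟩
    exact hx ⟨z, ball_subset_closedBall hz, rfl⟩
  have hfull : ∀ w ∈ ball (0 : ℂ) ε, h w ∈ K := by
    intro w hw
    rcases eq_or_ne w 0 with rfl | hw0
    · rwa [hh0]
    obtain ⟨z, hz, hzK⟩ := hmeet ‖w‖ (norm_pos_iff.2 hw0) (mem_ball_zero_iff.1 hw)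
    have hz0 : z ≠ 0 := norm_pos_iff.1 (hz ▸ norm_pos_iff.2 hw0)
    have hmem : ∀ μ : Circle, (μ : ℂ) * z ∈ ball (0 : ℂ) ε := fun μ => by
      rw [mem_ball_zero_iff, norm_mul, Circle.norm_coe, one_mul, hz]
      exact mem_ball_zero_iff.1 hw
    have hcl : IsClosed {μ : Circle | h (μ * z) ∈ K} := by
      refine hclosed.preimage ?_
      refine (hd.continuousOn.mono hsub).comp_continuous ?_ hmem
      exact continuous_subtype_val.mul continuous_const
    have horbit : ∀ n : ℕ, Circle.exp (2 * Real.pi * t) ^ n ∈ {μ : Circle | h (μ * z) ∈ K} := by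
      intro n
      induction n with
      | zero => simpa using hzK
      | succ n ih =>
        have := hF ih
        rw [(hball _ (hmem _)).1] at this
        rw [mem_ofPred_eq, pow_succ', Circle.coe_mul, Circle.coe_exp, mul_assoc]
        convert this using 4
        push_cast
        ring
    have hall : {μ : Circle | h (μ * z) ∈ K} = univ :=
      ((denseRange_pow_circle_exp ht).mono (range_subset_iff.2 horbit)).closure_eq ▸
        hcl.closure_eq.symm
    let μ : Circle := ⟨w / z, by
      rw [← SetLike.mem_coe, Submonoid.coe_unitSphere, mem_sphere_zero_iff_norm, norm_div, hz, div_self (norm_ne_zero_iff.2 hw0)]⟩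
    have hμ : μ ∈ {μ : Circle | h (μ * z) ∈ K} := hall ▸ mem_univ μ
    rwa [mem_ofPred_eq, show (μ : ℂ) * z = w from div_mul_cancel₀ w hz0] at hμ
  refine hnhds (mem_of_superset ((hopen _ Subset.rfl isOpen_ball).mem_nhds
    ⟨0, mem_ball_self hε, hh0⟩) ?_)
  rintro _ ⟨w, hw, rfl⟩
  exact hfull w hw

theorem isPreconnected_iInter_of_antitone {X : Type*} [TopologicalSpace X] [T2Space X]
    {s : ℕ → Set X} (hs : Antitone s) (hcomp : ∀ n, IsCompact (s n))
    (hconn : ∀ n, IsPreconnected (s n)) : IsPreconnected (⋂ n, s n) := by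
  have hI : IsCompact (⋂ n, s n) :=
    (hcomp 0).of_isClosed_subset (isClosed_iInter fun n => (hcomp n).isClosed) (iInter_subset s 0)
  rw [isPreconnected_closed_iff]
  intro A B hA hB hsub hIA hIB
  by_contra hempty
  rw [not_nonempty_iff_eq_empty] at hempty
  have hdisj : Disjoint ((⋂ n, s n) ∩ A) ((⋂ n, s n) ∩ B) := by
    rw [Set.disjoint_left]
    rintro x ⟨hx, hxA⟩ ⟨-, hxB⟩
    exact notMem_empty x (hempty ▸ ⟨hx, hxA, hxB⟩)
  obtain ⟨U, W, hU, hW, hAU, hBW, hUW⟩ :=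
    SeparatedNhds.of_isCompact_isCompact (hI.inter_right hA) (hI.inter_right hB) hdisj
  obtain ⟨n, hn⟩ := exists_subset_nhds_of_isCompact (U := U ∪ W)
    (directed_of_isDirected_le hs) hcomp
    (fun x hx => (hU.union hW).mem_nhds <| (hsub hx).imp (fun h => hAU ⟨hx, h⟩)
      fun h => hBW ⟨hx, h⟩)
  obtain ⟨x, hx, hxA⟩ := hIA
  obtain ⟨y, hy, hyB⟩ := hIB
  obtain ⟨z, -, hzU, hzW⟩ := hconn n U W hU hW hn
    ⟨x, mem_iInter.1 hx n, hAU ⟨hx, hxA⟩⟩ ⟨y, mem_iInter.1 hy n, hBW ⟨hy, hyB⟩⟩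
  exact Set.disjoint_left.1 hUW hzU hzW

theorem isPreconnected_compl_closedBall_zero {r : ℝ} (hr : 0 < r) :
    IsPreconnected (closedBall (0 : ℂ) r)ᶜ := by
  have himage : (closedBall (0 : ℂ) r)ᶜ = Complex.exp '' {w | Real.log r < w.re} := by
    ext z
    simp only [mem_compl_iff, mem_closedBall_zero_iff, not_le, mem_image, mem_ofPred_eq]
    constructor
    · intro hz
      have hz0 : z ≠ 0 := norm_pos_iff.1 (hr.trans hz)
      exact ⟨Complex.log z, by rw [Complex.log_re]; exact Real.log_lt_log hr hz,
        Complex.exp_log hz0⟩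
    · rintro ⟨w, hw, rfl⟩
      rw [Complex.norm_exp]
      exact (Real.log_lt_iff_lt_exp hr).1 hw
  rw [himage]
  exact (convex_halfSpace_re_gt _).isPreconnected.image _ Complex.continuous_exp.continuousOn

end Invariance

section Hedgehog

theorem disjoint_frontier_connectedComponentIn {X : Type*} [TopologicalSpace X]
    [LocallyConnectedSpace X] {F : Set X} (hF : IsOpen F) (x : X) :
    Disjoint (frontier (connectedComponentIn F x)) F := by
  rw [Set.disjoint_left]
  intro z hz hzF
  have hopen : ∀ y, IsOpen (connectedComponentIn F y) := fun y => hF.connectedComponentIn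
  obtain ⟨w, hwz, hwx⟩ := mem_closure_iff.1 (frontier_subset_closure hz) _ (hopen z)
    (mem_connectedComponentIn hzF)
  have hzx : z ∈ connectedComponentIn F x := by
    rw [connectedComponentIn_eq hwx, ← connectedComponentIn_eq hwz]
    exact mem_connectedComponentIn hzF
  rw [(hopen x).frontier_eq] at hz
  exact hz.2 hzx

namespace RotationStage

variable {r : ℝ} (S : RotationStage r)

theorem closedBall_one_subset : closedBall (0 : ℂ) 1 ⊆ ball 0 S.τ :=
  closedBall_subset_ball S.one_lt_τ

theorem isCompact_disk : IsCompact S.disk :=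
  (isCompact_closedBall 0 1).image_of_continuousOn
    (S.differentiableOn_H.continuousOn.mono S.closedBall_one_subset)

theorem isPreconnected_disk : IsPreconnected S.disk :=
  (convex_closedBall (0 : ℂ) 1).isPreconnected.image _
    (S.differentiableOn_H.continuousOn.mono S.closedBall_one_subset)

theorem zero_mem_disk : (0 : ℂ) ∈ S.disk := ⟨0, mem_closedBall_self zero_le_one, S.H_zero⟩

theorem norm_E_le_of_mem_disk {z : ℂ} (hz : z ∈ S.disk) : ‖S.E z‖ ≤ 1 := by
  obtain ⟨ζ, hζ, rfl⟩ := hz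
  rw [S.E_H ζ (S.closedBall_one_subset hζ)]
  exact mem_closedBall_zero_iff.1 hζ

theorem image_H_mem_nhds {ζ : ℂ} (hζ : ζ ∈ ball (0 : ℂ) S.τ) :
    S.H '' ball 0 S.τ ∈ nhds (S.H ζ) := by
  have hnhds := isOpen_ball.mem_nhds hζ
  have hH : HasStrictDerivAt S.H (deriv S.H ζ) ζ :=
    (S.differentiableOn_H.analyticAt hnhds).hasStrictDerivAt
  have hcomp : HasDerivAt (S.E ∘ S.H) (deriv S.E (S.H ζ) * deriv S.H ζ) ζ :=
    S.differentiable_E.differentiableAt.hasDerivAt.comp ζ hH.hasDerivAt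
  have hid : HasDerivAt (S.E ∘ S.H) 1 ζ :=
    (hasDerivAt_id ζ).congr_of_eventuallyEq (mem_of_superset hnhds fun w hw => S.E_H w hw)
  have hne : deriv S.H ζ ≠ 0 := right_ne_zero_of_mul (hcomp.unique hid ▸ one_ne_zero)
  rw [← hH.map_nhds_eq hne]
  exact image_mem_map hnhds

/-- By the maximum principle for `E`, a disk does not separate the plane. -/
theorem not_isBounded_connectedComponentIn_compl_disk {y : ℂ} (hy : y ∈ S.diskᶜ) :
    ¬ Bornology.IsBounded (connectedComponentIn S.diskᶜ y) := by
  intro hbdd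
  set W := connectedComponentIn S.diskᶜ y with hW
  have hcompl : IsOpen S.diskᶜ := S.isCompact_disk.isClosed.isOpen_compl
  have hWsub : W ⊆ S.diskᶜ := connectedComponentIn_subset _ _
  have hfront : frontier W ⊆ S.disk := fun z hz => by
    by_contra hcon
    exact Set.disjoint_left.1 (disjoint_frontier_connectedComponentIn hcompl y) hz hcon
  have hle : ∀ z ∈ W, ‖S.E z‖ ≤ 1 := fun z hz =>
    Complex.norm_le_of_forall_mem_frontier_norm_le hbdd S.differentiable_E.diffContOnCl
      (fun w hw => S.norm_E_le_of_mem_disk (hfront hw)) (subset_closure hz)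
  obtain ⟨b, hb⟩ : (frontier W).Nonempty :=
    nonempty_frontier_iff.2 ⟨⟨y, mem_connectedComponentIn hy⟩, fun hcon =>
      hWsub (hcon ▸ mem_univ 0) S.zero_mem_disk⟩
  obtain ⟨ζ, hζ, rfl⟩ := hfront hb
  obtain ⟨_, ⟨w, hw, rfl⟩, hwW⟩ := mem_closure_iff_nhds.1 (frontier_subset_closure hb) _
    (S.image_H_mem_nhds (S.closedBall_one_subset hζ))
  have h1 := hle _ hwW
  rw [S.E_H w hw] at h1
  exact hWsub hwW ⟨w, mem_closedBall_zero_iff.2 h1, rfl⟩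

theorem isPreconnected_compl_disk (hr : 0 < r) (hS : S.disk ⊆ closedBall 0 r) :
    IsPreconnected S.diskᶜ := by
  have hx : ((r + 1 : ℝ) : ℂ) ∈ (closedBall (0 : ℂ) r)ᶜ := by
    rw [mem_compl_iff, mem_closedBall_zero_iff, Complex.norm_real,
      Real.norm_of_nonneg (by linarith)]
    linarith
  refine isPreconnected_of_forall _ fun y hy =>
    ⟨(closedBall 0 r)ᶜ ∪ connectedComponentIn S.diskᶜ y,
      union_subset (compl_subset_compl.2 hS) (connectedComponentIn_subset _ _), Or.inl hx,
      Or.inr (mem_connectedComponentIn hy), ?_⟩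
  have hmeet : ((closedBall (0 : ℂ) r)ᶜ ∩ connectedComponentIn S.diskᶜ y).Nonempty := by
    obtain ⟨w, hw, hwr⟩ := not_subset.1 fun hsub =>
      S.not_isBounded_connectedComponentIn_compl_disk hy (isBounded_closedBall.subset hsub)
    exact ⟨w, hwr, hw⟩
  exact (isPreconnected_compl_closedBall_zero hr).union' hmeet isPreconnected_connectedComponentIn

end RotationStage

namespace RotationTower

variable {r : ℝ} {T : RotationTower r} {a : ℕ → Bool}

theorem antitone_disk : Antitone fun n => (T.stage n).disk :=
  antitone_nat_of_succ_le T.disk_succ_subset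

theorem disk_subset_closedBall (n : ℕ) : (T.stage n).disk ⊆ closedBall 0 r :=
  T.disk_zero ▸ antitone_disk (Nat.zero_le n)

theorem hedgehog_subset_closedBall : T.hedgehog ⊆ closedBall 0 r :=
  (iInter_subset _ 0).trans (disk_subset_closedBall 0)

theorem closedBall_subset_ball_two_mul (T : RotationTower r) : closedBall (0 : ℂ) r ⊆ ball 0 (2 * r) :=
  closedBall_subset_ball (by linarith [T.r_pos])

theorem isCompact_hedgehog : IsCompact T.hedgehog :=
  (T.stage 0).isCompact_disk.of_isClosed_subset
    (isClosed_iInter fun n => (T.stage n).isCompact_disk.isClosed) (iInter_subset _ 0)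

theorem zero_mem_hedgehog : (0 : ℂ) ∈ T.hedgehog :=
  mem_iInter.2 fun n => (T.stage n).zero_mem_disk

theorem isPreconnected_hedgehog : IsPreconnected T.hedgehog :=
  isPreconnected_iInter_of_antitone antitone_disk (fun n => (T.stage n).isCompact_disk)
    fun n => (T.stage n).isPreconnected_disk

theorem isConnected_compl_hedgehog : IsConnected T.hedgehogᶜ := by
  have hr := T.r_pos
  have hx : ((r + 1 : ℝ) : ℂ) ∉ closedBall (0 : ℂ) r := by
    rw [mem_closedBall_zero_iff, Complex.norm_real, Real.norm_of_nonneg (by linarith)]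
    linarith
  refine ⟨⟨_, fun h => hx (hedgehog_subset_closedBall h)⟩, ?_⟩
  rw [hedgehog, compl_iInter]
  exact isPreconnected_iUnion
    ⟨_, mem_iInter.2 fun n h => hx (disk_subset_closedBall n h)⟩
    fun n => (T.stage n).isPreconnected_compl_disk hr (disk_subset_closedBall n)

theorem closedBall_subset_hedgehog_union :
    closedBall 0 r ⊆ T.hedgehog ∪ ⋃ n, (T.stage n).disk \ (T.stage (n + 1)).disk := by
  intro x hx
  by_contra hcon
  rw [mem_union, not_or, mem_iUnion, not_exists] at hcon
  refine hcon.1 (mem_iInter.2 fun n => ?_)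
  induction n with
  | zero => rwa [T.disk_zero]
  | succ n ih =>
    by_contra hn
    exact hcon.2 n ⟨ih, hn⟩

theorem volume_hedgehog_pos : 0 < volume T.hedgehog := by
  rw [pos_iff_ne_zero]
  intro h0
  have h := (measure_mono T.closedBall_subset_hedgehog_union).trans
    ((measure_union_le (μ := volume) _ _).trans (add_le_add h0.le (measure_iUnion_le _)))
  rw [zero_add] at h
  exact h.not_gt T.tsum_volume_lt

theorem hedgehog_ne_singleton_zero : T.hedgehog ≠ {0} := fun h => by
  have := T.volume_hedgehog_pos
  rw [h, measure_singleton] at this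
  exact this.false

theorem hedgehog_notMem_nhds : T.hedgehog ∉ nhds (0 : ℂ) := by
  intro h
  obtain ⟨ε, hε, hsub⟩ := Metric.mem_nhds_iff.1 h
  obtain ⟨n, hn⟩ := exists_nat_one_div_lt hε
  obtain ⟨p, hp, hpn⟩ := T.exists_notMem_disk n
  exact hpn (mem_iInter.1 (hsub (mem_ball_zero_iff.2 (hp.trans hn))) (n + 1))

theorem limitMap_image_hedgehog : T.limitMap a '' T.hedgehog = T.hedgehog := by
  have hsub : T.hedgehog ⊆ ball 0 (2 * r) :=
    hedgehog_subset_closedBall.trans T.closedBall_subset_ball_two_mul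
  apply Subset.antisymm
  · rintro _ ⟨z, hz, rfl⟩
    refine mem_iInter.2 fun n => ?_
    refine (T.stage n).isCompact_disk.isClosed.mem_of_tendsto (tendsto_partialMap (hsub hz)) ?_
    filter_upwards [eventually_ge_atTop n] with m hm
    refine antitone_disk hm ?_
    change T.partialMap a m z ∈ (T.stage m).disk
    rw [← partialMap_image_disk (a := a) m.le_succ]
    exact mem_image_of_mem _ (mem_iInter.1 hz m)
  · intro y hy
    have hex : ∀ n, ∃ x ∈ (T.stage n).disk, T.partialMap a n x = y := fun n => by
      have := mem_iInter.1 hy n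
      rwa [← partialMap_image_disk (a := a) n.le_succ] at this
    choose x hx hxy using hex
    obtain ⟨z, hz, φ, hφ, hlim⟩ := (isCompact_closedBall (0 : ℂ) r).tendsto_subseq
      fun n => disk_subset_closedBall n (hx n)
    refine ⟨z, mem_iInter.2 fun n => ?_, ?_⟩
    · refine (T.stage n).isCompact_disk.isClosed.mem_of_tendsto hlim ?_
      filter_upwards [hφ.tendsto_atTop.eventually_ge_atTop n] with m hm
      exact antitone_disk hm (hx (φ m))
    · refine tendsto_nhds_unique (tendsto_partialMap_of_tendsto
        (T.closedBall_subset_ball_two_mul hz) hφ.tendsto_atTop hlim) ?_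
      exact tendsto_const_nhds.congr fun n => (hxy (φ n)).symm

theorem not_linearizable_limitMap {t : ℝ} (ht : Irrational t) :
    ¬ Linearizable t (T.limitMap a) :=
  not_linearizable_of_mapsTo isCompact_hedgehog.isClosed isPreconnected_hedgehog zero_mem_hedgehog
    hedgehog_ne_singleton_zero hedgehog_notMem_nhds
    (mapsTo_iff_image_subset.2 limitMap_image_hedgehog.subset) ht

end RotationTower

end Hedgehog

/-- There exist an uncountable compact set `A ⊆ ℝ`, a family `(f_t)_{t ∈ A}` of
holomorphic injective maps on the disk `{|z| < e^{-2π}}` with `f_t(0) = 0`,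
`f_t'(0) = e^{2πit}`, commuting pairwise near `0`, and a compact connected set
`K ⊆ {|z| ≤ e^{-2π}}` with `0 ∈ K`, `K ≠ {0}`, `ℂ ∖ K` connected, invariant under
every `f_t`, of strictly positive area, with `f_t` non-linearizable for every
irrational `t ∈ A`. -/
theorem exists_uncountable_semiflow_positive_area_hedgehog :
    ∃ (A : Set ℝ) (f : ℝ → ℂ → ℂ) (K : Set ℂ),
      IsCompact A ∧ ¬ A.Countable ∧
      (∀ t ∈ A,
        DifferentiableOn ℂ (f t) (Metric.ball 0 (Real.exp (-(2 * Real.pi)))) ∧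
        Set.InjOn (f t) (Metric.ball 0 (Real.exp (-(2 * Real.pi)))) ∧
        f t 0 = 0 ∧
        deriv (f t) 0 = Complex.exp (2 * Real.pi * Complex.I * t)) ∧
      (∀ s ∈ A, ∀ t ∈ A, ∀ᶠ z in nhds (0 : ℂ), f s (f t z) = f t (f s z)) ∧
      IsCompact K ∧ IsConnected K ∧ (0 : ℂ) ∈ K ∧ K ≠ {0} ∧
      K ⊆ Metric.closedBall 0 (Real.exp (-(2 * Real.pi))) ∧
      IsConnected Kᶜ ∧
      (∀ t ∈ A, f t '' K = K) ∧
      0 < MeasureTheory.volume K ∧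
      (∀ t ∈ A, Irrational t → ¬ Linearizable t (f t)) := by
  obtain ⟨T⟩ := exists_rotationTower (Real.exp_pos (-(2 * Real.pi)))
  have hinv : ∀ c, Function.invFun T.angle (T.angle c) = c :=
    Function.leftInverse_invFun RotationTower.injective_angle
  refine ⟨range T.angle, fun t => T.limitMap (Function.invFun T.angle t), T.hedgehog,
    T.isCompact_range_angle, T.not_countable_range_angle, ?_, ?_, T.isCompact_hedgehog,
    ⟨⟨0, T.zero_mem_hedgehog⟩, T.isPreconnected_hedgehog⟩, T.zero_mem_hedgehog,
    T.hedgehog_ne_singleton_zero, T.hedgehog_subset_closedBall, T.isConnected_compl_hedgehog,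
    fun t _ => T.limitMap_image_hedgehog, T.volume_hedgehog_pos,
    fun t _ ht => T.not_linearizable_limitMap ht⟩
  · rintro _ ⟨c, rfl⟩
    refine ⟨T.differentiableOn_limitMap.mono (ball_subset_ball (by linarith [T.r_pos])),
      T.injOn_limitMap, T.limitMap_zero, ?_⟩
    simp only [hinv, T.deriv_limitMap_zero]
  · intro s _ t _
    filter_upwards [ball_mem_nhds (0 : ℂ) T.r_pos] with z hz
    exact T.limitMap_comm hz
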